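/- arXiv:1205.0204 — 10 statements merged into one kernel-verified Lean document; each statement's English description precedes it below -/
import Mathlib

section
/- Let h : J → J be an involution on an open interval J ⊆ ℝ, let ω > 0, and define V(x) = (ω²/8)·(x − h(x))² for x ∈ J. Then the origin is an isochronous center of period 2π/ω for the equation ẍ = −V′(x): every twice differentiable function x : ℝ → ℝ satisfying x″(t) = −V′(x(t)) for all t ∈ ℝ and x(t) ∈ J for all t ∈ ℝ is periodic with period 2π/ω, i.e. x(t + 2π/ω) = x(t) for all t ∈ ℝ. -/
/-- An involution on an open interval `J ⊆ ℝ`: a C¹ diffeomorphism of `J` onto itself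
whose composition with itself is the identity on `J`, with `0 ∈ J`, `h 0 = 0`,
and `h' 0 = -1`. -/
def IsInvolutionOn (h : ℝ → ℝ) (J : Set ℝ) : Prop :=
  IsOpen J ∧ J.OrdConnected ∧ (0 : ℝ) ∈ J ∧
  Set.BijOn h J J ∧ ContDiffOn ℝ 1 h J ∧
  (∀ x ∈ J, h (h x) = x) ∧ h 0 = 0 ∧ HasDerivAt h (-1) 0

/-- if `h` is an involution on `J`, `ω > 0` and
`V x = (ω²/8) (x - h x)²` on `J`, then every global solution of `ẍ = -V'(x)`
whose values stay in `J` is periodic with period `2π/ω`. -/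
theorem isochronous_center_of_involution
    (J : Set ℝ) (h : ℝ → ℝ) (hinv : IsInvolutionOn h J)
    (ω : ℝ) (hω : 0 < ω)
    (V : ℝ → ℝ) (hV : ∀ y ∈ J, V y = ω ^ 2 / 8 * (y - h y) ^ 2)
    (x x' : ℝ → ℝ)
    (hx : ∀ t : ℝ, HasDerivAt x (x' t) t)
    (hx' : ∀ t : ℝ, HasDerivAt x' (-(deriv V (x t))) t)
    (hxJ : ∀ t : ℝ, x t ∈ J) :
    ∀ t : ℝ, x (t + 2 * Real.pi / ω) = x t := by
  obtain ⟨hJo, hJc, h0J, hbij, hC1, hhh, h00, hd0⟩ := hinv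
  have hmaps : ∀ a ∈ J, h a ∈ J := fun a ha => hbij.mapsTo ha
  have hder : ∀ a ∈ J, HasDerivAt h (deriv h a) a := fun a ha =>
    (((hC1.differentiableOn one_ne_zero) a ha).differentiableAt (hJo.mem_nhds ha)).hasDerivAt
  have hdc : ContinuousOn (deriv h) J := hC1.continuousOn_deriv_of_isOpen hJo le_rfl
  have hmul : ∀ a ∈ J, deriv h (h a) * deriv h a = 1 := by
    intro a ha
    have h1 : HasDerivAt (h ∘ h) (deriv h (h a) * deriv h a) a :=
      HasDerivAt.comp a (hder _ (hmaps a ha)) (hder a ha)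
    have h2 : HasDerivAt (h ∘ h) 1 a := by
      refine (hasDerivAt_id a).congr_of_eventuallyEq ?_
      filter_upwards [hJo.mem_nhds ha] with b hb
      simp [hhh b hb]
    exact h1.unique h2
  have hneg : ∀ a ∈ J, deriv h a < 0 := by
    intro a ha
    by_contra hcon
    push Not at hcon
    have := hJc.isPreconnected.intermediate_value h0J ha hdc
    have h3 : (0:ℝ) ∈ Set.Icc (deriv h 0) (deriv h a) := by
      rw [hd0.deriv]; exact ⟨by norm_num, hcon⟩
    obtain ⟨b, hb, hb0⟩ := this h3
    have := hmul b hb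
    rw [hb0] at this
    simp at this
  have hanti : StrictAntiOn h J := by
    refine strictAntiOn_of_deriv_neg hJc.convex hC1.continuousOn ?_
    intro a ha
    exact hneg a (interior_subset ha)
  have hinj : ∀ a ∈ J, ∀ b ∈ J, a - h a = b - h b → a = b := by
    intro a ha b hb hab
    rcases lt_trichotomy a b with hl | hl | hl
    · have := hanti ha hb hl; linarith
    · exact hl
    · have := hanti hb ha hl; linarith
  -- angular speed
  set q : ℝ → ℝ := fun t => ω * ((1 - deriv h (x t)) / 2) with hq
  have hxc : Continuous x := continuous_iff_continuousAt.2 fun t => (hx t).continuousAt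
  have hqc : Continuous q := by
    have : Continuous fun t => deriv h (x t) := hdc.comp_continuous hxc hxJ
    fun_prop
  have hqlow : ∀ t, ω / 2 < q t := by
    intro t
    have := hneg (x t) (hxJ t)
    simp only [hq]; nlinarith
  obtain ⟨θ, hθ⟩ : ∃ θ : ℝ → ℝ, ∀ t, HasDerivAt θ (q t) t :=
    ⟨fun t => ∫ s in (0:ℝ)..t, q s, fun t => hqc.integral_hasStrictDerivAt 0 t |>.hasDerivAt⟩
  have hθc : Continuous θ := continuous_iff_continuousAt.2 fun t => (hθ t).continuousAt
  have hθm : StrictMono θ := by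
    refine strictMono_of_deriv_pos fun t => ?_
    rw [(hθ t).deriv]
    have := hqlow t
    linarith
  have hgm : Monotone fun t => θ t - ω / 2 * t := by
    have hd : ∀ t, HasDerivAt (fun t => θ t - ω / 2 * t) (q t - ω / 2 * 1) t := fun t =>
      (hθ t).sub ((hasDerivAt_id t).const_mul (ω / 2))
    refine monotone_of_deriv_nonneg (fun t => (hd t).differentiableAt) fun t => ?_
    rw [(hd t).deriv]
    have := hqlow t
    linarith
  have hlin : Filter.Tendsto (fun t : ℝ => ω / 2 * t + θ 0) Filter.atTop Filter.atTop :=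
    Filter.tendsto_atTop_add_const_right _ _
      (Filter.tendsto_id.const_mul_atTop (by positivity : (0:ℝ) < ω / 2))
  have hlinb : Filter.Tendsto (fun t : ℝ => ω / 2 * t + θ 0) Filter.atBot Filter.atBot :=
    Filter.tendsto_atBot_add_const_right _ _
      (Filter.tendsto_id.const_mul_atBot (by positivity : (0:ℝ) < ω / 2))
  have htop : Filter.Tendsto θ Filter.atTop Filter.atTop := by
    refine Filter.tendsto_atTop_mono' _ ?_ hlin
    filter_upwards [Filter.eventually_ge_atTop 0] with t ht
    have := hgm ht
    simp only at this
    linarith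
  have hbot : Filter.Tendsto θ Filter.atBot Filter.atBot := by
    refine Filter.tendsto_atBot_mono' _ ?_ hlinb
    filter_upwards [Filter.eventually_le_atBot 0] with t ht
    have := hgm ht
    simp only at this
    linarith
  have hsurj : Function.Surjective θ := hθc.surjective htop hbot
  let e : ℝ ≃o ℝ := StrictMono.orderIsoOfSurjective θ hθm hsurj
  have he : ∀ t, e t = θ t := fun t => rfl
  let τ : ℝ → ℝ := fun φ => e.symm φ
  have hθτ : ∀ φ, θ (τ φ) = φ := fun φ => e.apply_symm_apply φ
  have hτθ : ∀ t, τ (θ t) = t := fun t => e.symm_apply_apply t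
  have hτc : Continuous τ := e.symm.continuous
  have hτd : ∀ φ, HasDerivAt τ (q (τ φ))⁻¹ φ := by
    intro φ
    refine HasDerivAt.of_local_left_inverse hτc.continuousAt (hθ (τ φ)) ?_ ?_
    · have := hqlow (τ φ)
      linarith
    · exact Filter.Eventually.of_forall hθτ
  -- the rotating pair
  set z : ℝ → ℝ := fun t => ω * ((x t - h (x t)) / 2) with hz
  have hzd : ∀ t, HasDerivAt z (q t * x' t) t := by
    intro t
    have h1 : HasDerivAt (fun t => h (x t)) (deriv h (x t) * x' t) t :=
      HasDerivAt.comp t (hder _ (hxJ t)) (hx t)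
    have := (((hx t).sub h1).div_const 2).const_mul ω
    refine this.congr_deriv ?_
    simp only [hq]; ring
  have hyd : ∀ t, HasDerivAt x' (-(q t * z t)) t := by
    intro t
    refine (hx' t).congr_deriv ?_
    have h1 : HasDerivAt (fun y => ω ^ 2 / 8 * (y - h y) ^ 2)
        (ω ^ 2 / 8 * ((2:ℕ) * (x t - h (x t)) ^ (2-1) * (1 - deriv h (x t)))) (x t) :=
      (((hasDerivAt_id (x t)).sub (hder _ (hxJ t))).pow 2).const_mul _
    have h2 : HasDerivAt V _ (x t) := h1.congr_of_eventuallyEq (by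
      filter_upwards [hJo.mem_nhds (hxJ t)] with b hb
      exact hV b hb)
    rw [h2.deriv]
    simp only [hq, hz]
    push_cast
    ring
  have hcosd : ∀ t, HasDerivAt (fun t => Real.cos (θ t)) (-Real.sin (θ t) * q t) t :=
    fun t => (hθ t).cos
  have hsind : ∀ t, HasDerivAt (fun t => Real.sin (θ t)) (Real.cos (θ t) * q t) t :=
    fun t => (hθ t).sin
  have hA : ∀ s t, z s * Real.cos (θ s) - x' s * Real.sin (θ s)
      = z t * Real.cos (θ t) - x' t * Real.sin (θ t) := by
    have hd : ∀ t, HasDerivAt (fun t => z t * Real.cos (θ t) - x' t * Real.sin (θ t)) 0 t := by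
      intro t
      refine (((hzd t).mul (hcosd t)).sub ((hyd t).mul (hsind t))).congr_deriv ?_
      ring
    exact is_const_of_deriv_eq_zero (fun t => (hd t).differentiableAt) fun t => (hd t).deriv
  have hB : ∀ s t, z s * Real.sin (θ s) + x' s * Real.cos (θ s)
      = z t * Real.sin (θ t) + x' t * Real.cos (θ t) := by
    have hd : ∀ t, HasDerivAt (fun t => z t * Real.sin (θ t) + x' t * Real.cos (θ t)) 0 t := by
      intro t
      refine (((hzd t).mul (hsind t)).add ((hyd t).mul (hcosd t))).congr_deriv ?_
      ring
    exact is_const_of_deriv_eq_zero (fun t => (hd t).differentiableAt) fun t => (hd t).deriv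
  obtain ⟨A, B, hzAB⟩ : ∃ A B : ℝ, ∀ t, z t = A * Real.cos (θ t) + B * Real.sin (θ t) := by
    refine ⟨z 0 * Real.cos (θ 0) - x' 0 * Real.sin (θ 0),
      z 0 * Real.sin (θ 0) + x' 0 * Real.cos (θ 0), fun t => ?_⟩
    rw [hA 0 t, hB 0 t]
    linear_combination (-(z t)) * Real.sin_sq_add_cos_sq (θ t)
  have hflip : ∀ φ, x (τ (φ + Real.pi)) = h (x (τ φ)) := by
    intro φ
    have h1 := hzAB (τ (φ + Real.pi))
    have h2 := hzAB (τ φ)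
    rw [hθτ, Real.cos_add_pi, Real.sin_add_pi] at h1
    rw [hθτ] at h2
    have h3 : z (τ (φ + Real.pi)) = - z (τ φ) := by rw [h1, h2]; ring
    simp only [hz] at h3
    apply hinj _ (hxJ _) _ (hmaps _ (hxJ _))
    rw [hhh _ (hxJ _)]
    apply mul_left_cancel₀ hω.ne'
    linarith
  have hG : ∀ φ ψ, τ φ + τ (φ + Real.pi) - 2 / ω * φ = τ ψ + τ (ψ + Real.pi) - 2 / ω * ψ := by
    have hd : ∀ φ, HasDerivAt (fun φ => τ φ + τ (φ + Real.pi) - 2 / ω * φ) 0 φ := by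
      intro φ
      have h1 := ((hτd φ).add ((hτd (φ + Real.pi)).comp_add_const φ Real.pi)).sub
        ((hasDerivAt_id φ).const_mul (2 / ω))
      refine h1.congr_deriv ?_
      simp only [hq, hflip]
      have h2 := hmul _ (hxJ (τ φ))
      have h3 := hneg _ (hxJ (τ φ))
      have h4 := hneg _ (hmaps _ (hxJ (τ φ)))
      generalize deriv h (h (x (τ φ))) = b at *
      generalize deriv h (x (τ φ)) = a at *
      have h5 : 1 - a ≠ 0 := by linarith
      have h6 : 1 - b ≠ 0 := by linarith
      field_simp
      linear_combination (-2) * h2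
    exact is_const_of_deriv_eq_zero (fun t => (hd t).differentiableAt) fun t => (hd t).deriv
  intro t
  have hper : τ (θ t + Real.pi + Real.pi) = t + 2 * Real.pi / ω := by
    have h1 := hG (θ t + Real.pi) (θ t)
    rw [hτθ] at h1
    linear_combination h1
  rw [← hper, hflip, hflip, hτθ, hhh _ (hxJ t)]
end

section
/- Let g be continuous on an open interval I containing 0 with g(0) = 0, x·g(x) > 0 for all x ∈ I with x ≠ 0, and suppose g is differentiable at 0 with g′(0) > 0. Set ω = √(g′(0)) and V(x) = ∫₀ˣ g(s) ds. Suppose the origin is an isochronous center for ẍ = −g(x): there exists ε > 0 such that every twice differentiable solution x : ℝ → ℝ of x″(t) = −g(x(t)) with x′(0) = 0 and 0 < x(0) < ε is periodic with period 2π/ω. Then there exist an open interval J ⊆ I with 0 ∈ J and an involution h : J → J such that V(x) = (ω²/8)·(x − h(x))² for all x ∈ J. -/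
open Real Set Filter Topology

lemma aux_inverse (f f' : ℝ → ℝ) (m : ℝ) (hm : 0 < m) (hf : ∀ x, HasDerivAt f (f' x) x)
    (hb : ∀ x, m ≤ f' x) :
    ∃ X : ℝ → ℝ, (∀ x, X (f x) = x) ∧ (∀ y, f (X y) = y) ∧ StrictMono X ∧
      (∀ y, HasDerivAt X (1 / f' (X y)) y) := by
  have hd : Differentiable ℝ f := fun x => (hf x).differentiableAt
  have hmono : StrictMono f := strictMono_of_deriv_pos (fun x => by
    rw [(hf x).deriv]; linarith [hb x])
  have hkey : Monotone (fun x => f x - m * x) := by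
    apply monotone_of_deriv_nonneg
    · fun_prop
    · intro x
      have : HasDerivAt (fun x => f x - m * x) (f' x - m * 1) x :=
        (hf x).sub ((hasDerivAt_id x).const_mul m)
      rw [this.deriv]; linarith [hb x]
  have htop : Tendsto f atTop atTop := by
    have h1 : Tendsto (fun x : ℝ => f 0 + m * x) atTop atTop :=
      tendsto_atTop_add_const_left _ _ (tendsto_id.const_mul_atTop hm)
    refine tendsto_atTop_mono' _ ?_ h1
    filter_upwards [eventually_ge_atTop 0] with x hx
    have := hkey hx
    simp at this; linarith
  have hbot : Tendsto f atBot atBot := by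
    have h1 : Tendsto (fun x : ℝ => f 0 + m * x) atBot atBot :=
      tendsto_atBot_add_const_left _ _ (tendsto_id.const_mul_atBot hm)
    refine tendsto_atBot_mono' _ ?_ h1
    filter_upwards [eventually_le_atBot 0] with x hx
    have := hkey hx
    simp at this; linarith
  have hsurj : Function.Surjective f := hd.continuous.surjective htop hbot
  let e := hmono.orderIsoOfSurjective f hsurj
  have he : ∀ x, e x = f x := fun x => rfl
  have h2 : ∀ y, f (e.symm y) = y := fun y => by rw [← he]; exact e.apply_symm_apply y
  refine ⟨e.symm, fun x => by rw [← he]; exact e.symm_apply_apply x, h2, e.symm.strictMono, ?_⟩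
  intro y
  have := HasDerivAt.of_local_left_inverse (f := f) (g := e.symm) (f' := f' (e.symm y)) (a := y)
    (e.symm.continuous.continuousAt) (hf _) (by linarith [hb (e.symm y)])
    (Eventually.of_forall h2)
  simpa using this

lemma aux_wallis (n : ℕ) : (∫ x in (0:ℝ)..π, sin x ^ n) * (∫ x in (0:ℝ)..π, sin x ^ (n+1)) =
    2 * π / (n + 1) := by
  induction n with
  | zero => simp [integral_sin]; ring
  | succ n ih =>
    rw [integral_sin_pow (n := n)]
    simp only [sin_zero, sin_pi]
    push_cast
    have h : ((n:ℝ) + 1 + 1) ≠ 0 := by positivity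
    have h' : ((n:ℝ) + 1) ≠ 0 := by positivity
    have h'' : ((n:ℝ) + 2) ≠ 0 := by positivity
    rw [mul_comm] at ih
    have e : (∫ x in (0:ℝ)..π, sin x ^ (n+1)) * ((0 ^ (n + 1) * cos 0 - 0 ^ (n + 1) * cos π) / ((n:ℝ) + 2) + (n + 1) / (n + 2) * ∫ x in (0:ℝ)..π, sin x ^ n) = ((n:ℝ)+1)/(n+2) * ((∫ x in (0:ℝ)..π, sin x ^ (n+1)) * (∫ x in (0:ℝ)..π, sin x ^ n)) := by
      simp; ring
    rw [e, ih]
    field_simp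
    ring

lemma aux_poly (p : Polynomial ℝ) (ρ : ℝ) :
    ∫ a in (0:ℝ)..π, (∫ s in (0:ℝ)..π, p.eval (ρ * sin a * sin s)) * (ρ * sin a) =
      2 * π * ∫ r in (0:ℝ)..ρ, p.eval r := by
  have hc : ∀ p : Polynomial ℝ, Continuous (fun a => (∫ s in (0:ℝ)..π, p.eval (ρ * sin a * sin s)) * (ρ * sin a)) := by
    intro p
    refine Continuous.mul ?_ (by fun_prop)
    apply intervalIntegral.continuous_parametric_intervalIntegral_of_continuous'
    simp only [Function.uncurry_def]
    fun_prop
  induction p using Polynomial.induction_on' with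
  | add p q hp hq =>
    have hi : ∀ p : Polynomial ℝ, ∀ c a b : ℝ, IntervalIntegrable (fun s => p.eval (c * sin s)) MeasureTheory.volume a b := by
      intro p c a b
      apply Continuous.intervalIntegrable; fun_prop
    have hi2 : ∀ p : Polynomial ℝ, ∀ a b : ℝ, IntervalIntegrable (fun s => p.eval s) MeasureTheory.volume a b := by
      intro p a b
      apply Continuous.intervalIntegrable; fun_prop
    simp only [Polynomial.eval_add]
    rw [intervalIntegral.integral_add (hi2 _ _ _) (hi2 _ _ _), mul_add, ← hp, ← hq,
      ← intervalIntegral.integral_add ((hc p).intervalIntegrable _ _) ((hc q).intervalIntegrable _ _)]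
    congr 1
    ext a
    rw [intervalIntegral.integral_add (hi _ _ _ _) (hi _ _ _ _)]
    ring
  | monomial n c =>
    simp only [Polynomial.eval_monomial, mul_pow, intervalIntegral.integral_const_mul]
    have := aux_wallis n
    have e : ∀ a : ℝ, c * (ρ ^ n * sin a ^ n * ∫ (x : ℝ) in 0..π, sin x ^ n) * (ρ * sin a)
      = (c * ρ^(n+1) * ∫ (x : ℝ) in 0..π, sin x ^ n) * sin a ^ (n+1) := by intro a; ring
    simp only [e, intervalIntegral.integral_const_mul]
    rw [mul_assoc, this, integral_pow]
    simp; ring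

lemma aux_abel (f : ℝ → ℝ) (hf : Continuous f) (ρ : ℝ) (hρ : 0 ≤ ρ)
    (hF : ∀ r, 0 ≤ r → r ≤ ρ → ∫ s in (0:ℝ)..π, f (r * sin s) = 0) :
    ∫ r in (0:ℝ)..ρ, f r = 0 := by
  have key : ∀ ε > 0, |∫ r in (0:ℝ)..ρ, f r| ≤ ε * (3 * ρ) := by
    intro ε hε
    obtain ⟨p, hp⟩ := exists_polynomial_near_of_continuousOn 0 ρ f hf.continuousOn ε hε
    have hpi := pi_pos
    have h1 : ∀ r, 0 ≤ r → r ≤ ρ → |∫ s in (0:ℝ)..π, p.eval (r * sin s)| ≤ ε * π := by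
      intro r hr0 hr
      have e : ∫ s in (0:ℝ)..π, p.eval (r * sin s) =
          ∫ s in (0:ℝ)..π, (p.eval (r * sin s) - f (r * sin s)) := by
        rw [intervalIntegral.integral_sub, hF r hr0 hr, sub_zero]
        all_goals (apply Continuous.intervalIntegrable; fun_prop)
      rw [e]
      have := intervalIntegral.norm_integral_le_of_norm_le_const (a := 0) (b := π) (C := ε)
        (f := fun s => p.eval (r * sin s) - f (r * sin s)) (by
          intro s hs
          rw [uIoc_of_le hpi.le] at hs
          have h0 : 0 ≤ sin s := sin_nonneg_of_nonneg_of_le_pi hs.1.le hs.2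
          refine (hp _ ⟨by positivity, ?_⟩).le
          nlinarith [sin_le_one s])
      rwa [sub_zero, abs_of_pos hpi] at this
    have h2 : |2 * π * ∫ r in (0:ℝ)..ρ, p.eval r| ≤ ε * π * ρ * π := by
      rw [← aux_poly]
      have := intervalIntegral.norm_integral_le_of_norm_le_const (a := 0) (b := π) (C := ε * π * ρ)
        (f := fun a => (∫ s in (0:ℝ)..π, p.eval (ρ * sin a * sin s)) * (ρ * sin a)) (by
          intro s hs
          rw [uIoc_of_le hpi.le] at hs
          have h0 : 0 ≤ sin s := sin_nonneg_of_nonneg_of_le_pi hs.1.le hs.2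
          have h3 : ρ * sin s ≤ ρ := by nlinarith [sin_le_one s]
          have h4 : 0 ≤ ρ * sin s := by positivity
          rw [norm_mul, Real.norm_eq_abs, Real.norm_eq_abs, abs_of_nonneg h4]
          exact mul_le_mul (h1 _ h4 h3) h3 h4 (by positivity))
      rwa [sub_zero, abs_of_pos hpi] at this
    have h3 : |∫ r in (0:ℝ)..ρ, (p.eval r - f r)| ≤ ε * ρ := by
      have := intervalIntegral.norm_integral_le_of_norm_le_const (a := 0) (b := ρ) (C := ε)
        (f := fun s => p.eval s - f s) (by
          intro s hs
          rw [uIoc_of_le hρ] at hs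
          exact (hp _ ⟨hs.1.le, hs.2⟩).le)
      rwa [sub_zero, abs_of_nonneg hρ] at this
    rw [intervalIntegral.integral_sub (Continuous.intervalIntegrable (by fun_prop) _ _)
      (hf.intervalIntegrable _ _)] at h3
    rw [abs_mul, abs_of_pos (by positivity : 0 < 2 * π)] at h2
    have h4 : |∫ r in (0:ℝ)..ρ, p.eval r| ≤ ε * ρ * 2 := by
      have : |∫ r in (0:ℝ)..ρ, p.eval r| * 2 * π ≤ (ε * ρ * π) * π := by linarith
      have := le_of_mul_le_mul_right this hpi
      have : ε * ρ * π ≤ ε * ρ * 4 := mul_le_mul_of_nonneg_left pi_le_four (by positivity)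
      linarith
    rw [abs_le] at *
    constructor <;> linarith [h3.1, h3.2, h4.1, h4.2]
  by_contra hne
  have hpos := abs_pos.mpr hne
  have hk := key (|∫ r in (0:ℝ)..ρ, f r| / (3 * ρ + 1)) (by positivity)
  rw [div_mul_eq_mul_div, le_div_iff₀ (by positivity)] at hk
  nlinarith

/-- the period integral is determined -/
lemma aux_period (I : Set ℝ) (g : ℝ → ℝ) (ω ε : ℝ) (hω : 0 < ω)
    (hiso : ∀ x x' : ℝ → ℝ,
      (∀ t : ℝ, HasDerivAt x (x' t) t) →
      (∀ t : ℝ, HasDerivAt x' (-(g (x t))) t) →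
      (∀ t : ℝ, x t ∈ I) →
      x' 0 = 0 → 0 < x 0 → x 0 < ε →
      ∀ t : ℝ, x (t + 2 * Real.pi / ω) = x t)
    (X φ : ℝ → ℝ) (hφ : Continuous φ) (m : ℝ) (hm : 0 < m) (hφm : ∀ y, m ≤ φ y)
    (hX : ∀ y, HasDerivAt X (φ y) y) (hXm : StrictMono X) (hX0 : X 0 = 0)
    (r : ℝ) (hr : 0 < r) (hI : ∀ y, |y| ≤ r → X y ∈ I)
    (hg : ∀ y, |y| ≤ r → g (X y) = y / φ y) (hXr : X r < ε)
    (hlow : ∀ y, |y| ≤ r → 1 / (2 * ω) < φ y) :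
    ∫ s in (0:ℝ)..π, (φ (r * sin s) + φ (-(r * sin s))) = 2 * π / ω := by
  have hpi := pi_pos
  have hφpos : ∀ y, 0 < φ y := fun y => lt_of_lt_of_le hm (hφm y)
  have hc : Continuous (fun s => φ (r * sin s)) := by fun_prop
  have habs : ∀ s, |r * sin s| ≤ r := by
    intro s
    rw [abs_mul, abs_of_pos hr]
    nlinarith [abs_sin_le_one s]
  set τ : ℝ → ℝ := fun θ => ∫ s in (π/2)..θ, φ (r * sin s) with hτ
  have hτd : ∀ θ, HasDerivAt τ (φ (r * sin θ)) θ := fun θ => hc.integral_hasStrictDerivAt _ _ |>.hasDerivAt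
  obtain ⟨Θ, hΘτ, hτΘ, hΘm, hΘd⟩ := aux_inverse τ (fun θ => φ (r * sin θ)) m hm hτd (fun _ => hφm _)
  have hτ0 : τ (π/2) = 0 := by simp [hτ]
  have hΘ0 : Θ 0 = π/2 := by rw [← hτ0, hΘτ]
  have hper := hiso (fun t => X (r * sin (Θ t))) (fun t => r * cos (Θ t)) (by
      intro t
      have h1 := (hX (r * sin (Θ t))).comp t (((hΘd t).sin).const_mul r)
      have : φ (r * sin (Θ t)) * (r * (cos (Θ t) * (1 / φ (r * sin (Θ t))))) = r * cos (Θ t) := by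
        have := (hφpos (r * sin (Θ t))).ne'
        field_simp
      rw [this] at h1
      exact h1) (by
      intro t
      have h1 := ((hΘd t).cos).const_mul r
      rw [hg _ (habs _)]
      have e : -(r * sin (Θ t) / φ (r * sin (Θ t))) =
          r * (-sin (Θ t) * (1 / φ (r * sin (Θ t)))) := by ring
      rw [e]
      exact h1) (fun t => hI _ (habs _)) (by simp [hΘ0]) (by
        simp only [hΘ0, sin_pi_div_two, mul_one]; rw [← hX0]; exact hXm hr) (by
        simpa [hΘ0] using hXr) 0
  simp only [zero_add, hΘ0, sin_pi_div_two, mul_one] at hper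
  have h1 : r * sin (Θ (2 * π / ω)) = r := hXm.injective hper
  have h2 : sin (Θ (2 * π / ω)) = 1 := by
    have : r * sin (Θ (2 * π / ω)) = r * 1 := by rw [h1, mul_one]
    exact mul_left_cancel₀ hr.ne' this
  obtain ⟨k, hk⟩ := (sin_eq_one_iff).1 h2
  have hTpos : 0 < 2 * π / ω := by positivity
  have hkpos : 0 < k := by
    have := hΘm hTpos
    rw [hΘ0, ← hk] at this
    have h3 : 0 < (k:ℝ) * (2 * π) := by linarith
    have h4 : 0 < (k:ℝ) := by
      by_contra hcon
      push Not at hcon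
      nlinarith
    exact_mod_cast h4
  have hP : Function.Periodic (fun s => φ (r * sin s)) (2 * π) := by
    intro s; simp
  have h5 : 2 * π / ω = k * ∫ s in (0:ℝ)..2 * π, φ (r * sin s) := by
    rw [← hτΘ (2 * π / ω), ← hk, hτ]
    have e := hP.intervalIntegral_add_zsmul_eq k (π/2) (fun a b => hc.intervalIntegrable _ _)
    have e2 := hP.intervalIntegral_add_eq (π/2) 0
    rw [zero_add] at e2
    rw [e2] at e
    simp only [zsmul_eq_mul] at e
    rw [← e]
  have hlow2 : π / ω < ∫ s in (0:ℝ)..2 * π, φ (r * sin s) := by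
    have e : ∫ s in (0:ℝ)..2 * π, 1 / (2 * ω) = π / ω := by
      simp; field_simp
    rw [← e]
    apply intervalIntegral.integral_lt_integral_of_continuousOn_of_le_of_exists_lt (by positivity)
      continuousOn_const hc.continuousOn
    · intro s _; exact (hlow _ (habs _)).le
    · exact ⟨0, ⟨le_rfl, by positivity⟩, hlow _ (habs _)⟩
  have hk1 : k = 1 := by
    by_contra hne
    have h6 : 2 ≤ k := by omega
    have h7 : (2:ℝ) ≤ k := by exact_mod_cast h6
    have h8 : 0 < π / ω := by positivity
    have h9 : 2 * π / ω = 2 * (π / ω) := by ring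
    nlinarith
  rw [hk1] at h5
  simp only [Int.cast_one, one_mul] at h5
  rw [h5, intervalIntegral.integral_add (hc.intervalIntegrable _ _)
    (Continuous.intervalIntegrable (by fun_prop) _ _),
    ← intervalIntegral.integral_add_adjacent_intervals (a := 0) (b := π) (c := 2 * π) (hc.intervalIntegrable _ _) (hc.intervalIntegrable _ _)]
  congr 1
  have := intervalIntegral.integral_comp_add_right (a := 0) (b := π) (fun s => φ (r * sin s)) π
  simp only [sin_add_pi, zero_add, mul_neg] at this
  rw [this]; congr 1; ring

lemma aux_U (I : Set ℝ) (hIopen : IsOpen I) (hIint : I.OrdConnected) (h0I : (0 : ℝ) ∈ I)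
    (g : ℝ → ℝ) (hgcont : ContinuousOn g I) (hg0 : g 0 = 0)
    (hsign : ∀ x ∈ I, x ≠ 0 → 0 < x * g x)
    (g'0 : ℝ) (hgd : HasDerivAt g g'0 0) (hg'pos : 0 < g'0)
    (V : ℝ → ℝ) (hVdef : ∀ x : ℝ, V x = ∫ s in (0 : ℝ)..x, g s) :
    ∃ (U w : ℝ → ℝ) (δ m M : ℝ), 0 < δ ∧ 0 < m ∧ 0 < M ∧ Continuous w ∧
      (∀ x, m ≤ w x) ∧ (∀ x, w x ≤ M) ∧ (∀ x, HasDerivAt U (w x) x) ∧ U 0 = 0 ∧ w 0 = √g'0 ∧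
      ∀ x, |x| ≤ δ → x ∈ I ∧ U x ^ 2 = 2 * V x ∧ U x * w x = g x := by
  have hInhds : ∀ x ∈ I, I ∈ 𝓝 x := fun x hx => hIopen.mem_nhds hx
  have hsub : ∀ x ∈ I, uIcc 0 x ⊆ I := fun x hx => hIint.uIcc_subset h0I hx
  have hV0 : V 0 = 0 := by simp [hVdef]
  have hVd : ∀ x ∈ I, HasDerivAt V (g x) x := by
    intro x hx
    have : V = fun x => ∫ s in (0 : ℝ)..x, g s := funext hVdef
    rw [this]
    refine intervalIntegral.integral_hasDerivAt_right
      ((hgcont.mono (hsub x hx)).intervalIntegrable) ?_ (hgcont.continuousAt (hInhds x hx))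
    exact hgcont.stronglyMeasurableAtFilter hIopen x hx
  have hgpos : ∀ x ∈ I, 0 < x → 0 < g x := fun x hx h => by
    have := hsign x hx h.ne'; exact pos_of_mul_pos_right this h.le
  have hgneg : ∀ x ∈ I, x < 0 → g x < 0 := fun x hx h => by
    have := hsign x hx h.ne; exact neg_of_mul_pos_right this h.le
  have hVpos : ∀ x ∈ I, x ≠ 0 → 0 < V x := by
    intro x hx hne
    rcases lt_or_gt_of_ne hne with h | h
    · have hs := hsub x hx
      rw [uIcc_of_ge h.le] at hs
      have := strictAntiOn_of_deriv_neg (convex_Icc x 0) (f := V)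
        (fun y hy => (hVd y (hs hy)).continuousAt.continuousWithinAt)
        (fun y hy => by
          rw [interior_Icc] at hy
          have hyI := hs (Ioo_subset_Icc_self hy)
          rw [(hVd y hyI).deriv]; exact hgneg y hyI hy.2)
      have := this ⟨le_rfl, h.le⟩ ⟨h.le, le_rfl⟩ h
      rwa [hV0] at this
    · have hs := hsub x hx
      rw [uIcc_of_le h.le] at hs
      have := strictMonoOn_of_deriv_pos (convex_Icc 0 x) (f := V)
        (fun y hy => (hVd y (hs hy)).continuousAt.continuousWithinAt)
        (fun y hy => by
          rw [interior_Icc] at hy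
          have hyI := hs (Ioo_subset_Icc_self hy)
          rw [(hVd y hyI).deriv]; exact hgpos y hyI hy.1)
      have := this ⟨le_rfl, h.le⟩ ⟨h.le, le_rfl⟩ h
      rwa [hV0] at this
  have hω : 0 < √g'0 := sqrt_pos.mpr hg'pos
  -- limits at 0
  have hgx : Tendsto (fun x => g x / x) (𝓝[≠] 0) (𝓝 g'0) := by
    have := hgd.tendsto_slope
    refine this.congr (fun x => ?_)
    simp [slope_def_field, hg0]
  have hI0 : ∀ᶠ x in 𝓝[≠] (0:ℝ), x ∈ I := mem_nhdsWithin_of_mem_nhds (hInhds 0 h0I)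
  have hne0 : ∀ᶠ x in 𝓝[≠] (0:ℝ), x ≠ 0 := self_mem_nhdsWithin
  have hVx : Tendsto (fun x => V x / x ^ 2) (𝓝[≠] 0) (𝓝 (g'0 / 2)) := by
    refine HasDerivAt.lhopital_zero_nhdsNE (f' := g) (g' := fun x => 2 * x) ?_ ?_ ?_ ?_ ?_ ?_
    · filter_upwards [hI0] with x hx using hVd x hx
    · refine Eventually.of_forall (fun x => ?_)
      simpa using hasDerivAt_pow 2 x
    · filter_upwards [hne0] with x hx
      simpa using hx
    · have := (hVd 0 h0I).continuousAt.tendsto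
      rw [hV0] at this
      exact this.mono_left nhdsWithin_le_nhds
    · have : Tendsto (fun x : ℝ => x ^ 2) (𝓝 0) (𝓝 (0 ^ 2)) := (continuous_pow 2).tendsto 0
      simp only [ne_eq, OfNat.ofNat_ne_zero, not_false_eq_true, zero_pow] at this
      exact this.mono_left nhdsWithin_le_nhds
    · refine (hgx.div_const 2).congr (fun x => ?_)
      rw [div_div, mul_comm]
  set u : ℝ → ℝ := fun x => x * √(2 * (V x / x ^ 2)) with hu
  have hu0 : u 0 = 0 := by simp [hu]
  have hux : Tendsto (fun x => √(2 * (V x / x ^ 2))) (𝓝[≠] 0) (𝓝 (√g'0)) := by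
    have := (hVx.const_mul 2).sqrt
    rwa [mul_div_cancel₀ _ (by norm_num : (2:ℝ) ≠ 0)] at this
  have husq : ∀ x ∈ I, u x ^ 2 = 2 * V x := by
    intro x hx
    by_cases h : x = 0
    · simp [h, hu0, hV0]
    · have := hVpos x hx h
      simp only [hu]
      rw [mul_pow, sq_sqrt (by positivity)]
      field_simp
  set v : ℝ → ℝ := fun x => if x = 0 then √g'0 else g x / u x with hv
  have hsq : ∀ x ∈ I, x ≠ 0 → 0 < √(2 * (V x / x ^ 2)) := by
    intro x hx h
    have := hVpos x hx h
    positivity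
  have hune : ∀ x ∈ I, x ≠ 0 → u x ≠ 0 := by
    intro x hx h
    exact mul_ne_zero h (hsq x hx h).ne'
  have huv : ∀ x ∈ I, u x * v x = g x := by
    intro x hx
    by_cases h : x = 0
    · simp [h, hu0, hg0]
    · simp only [hv, if_neg h]
      field_simp [hune x hx h]
  have hvpos : ∀ x ∈ I, 0 < v x := by
    intro x hx
    by_cases h : x = 0
    · simpa [h, hv] using hω
    · simp only [hv, if_neg h]
      have e : g x / u x = (x * g x) / (x ^ 2 * √(2 * (V x / x ^ 2))) := by
        simp only [hu]
        have := (hsq x hx h).ne'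
        generalize √(2 * (V x / x ^ 2)) = q at *
        field_simp
      rw [e]
      have := hsign x hx h
      have := hsq x hx h
      positivity
  have hud : ∀ x ∈ I, x ≠ 0 → HasDerivAt u (v x) x := by
    intro x hx h
    have hV := hVpos x hx h
    have h1 : HasDerivAt (fun x => x * √(2 * (V x / x ^ 2))) _ x :=
      (hasDerivAt_id x).mul ((((hVd x hx).div (hasDerivAt_pow 2 x) (by positivity)).const_mul 2).sqrt (by simp only [Pi.div_apply]; positivity))
    convert h1 using 1
    simp only [hv, if_neg h, hu, id]
    have hs := hsq x hx h
    have hs2 : √(2 * (V x / x ^ 2)) ^ 2 = 2 * (V x / x ^ 2) := sq_sqrt (by positivity)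
    simp only [Pi.div_apply]
    generalize √(2 * (V x / x ^ 2)) = q at *
    field_simp at hs2 ⊢
    push_cast
    simp
    linear_combination (-x) * hs2
  have hucont0 : ContinuousAt u 0 := by
    rw [continuousAt_iff_punctured_nhds, hu0]
    have : Tendsto (fun x : ℝ => x) (𝓝[≠] 0) (𝓝 0) := tendsto_id.mono_left nhdsWithin_le_nhds
    have h2 := this.mul hux
    rw [zero_mul] at h2
    exact h2
  have hvcont : ContinuousOn v I := by
    intro x hx
    apply ContinuousAt.continuousWithinAt
    by_cases h : x = 0
    · rw [h, continuousAt_iff_punctured_nhds]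
      have h1 : v 0 = g'0 / √g'0 := by simp [hv]
      rw [h1]
      refine (hgx.div hux hω.ne').congr' ?_
      filter_upwards [hne0] with x hx
      simp only [hv, if_neg hx, hu, Pi.div_apply]
      rw [div_div]
    · have h1 : ContinuousAt (fun x => g x / u x) x :=
        (hgcont.continuousAt (hInhds x hx)).div (hud x hx h).continuousAt (hune x hx h)
      refine h1.congr ?_
      filter_upwards [isOpen_ne.mem_nhds h] with y hy
      simp only [hv]
      rw [if_neg hy]
  have hud' : ∀ x ∈ I, HasDerivAt u (v x) x := by
    intro x hx
    by_cases h : x = 0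
    · subst h
      rw [hasDerivAt_iff_tendsto_slope]
      have : v 0 = √g'0 := by simp [hv]
      rw [this]
      refine hux.congr' ?_
      filter_upwards [hne0] with x hx
      rw [slope_def_field, hu0]
      simp only [hu, sub_zero]
      field_simp
    · exact hud x hx h
  obtain ⟨δ, hδ, hδI⟩ := Metric.nhds_basis_closedBall.mem_iff.1 (hInhds 0 h0I)
  rw [Real.closedBall_eq_Icc, zero_sub, zero_add] at hδI
  have hle : -δ ≤ δ := by linarith
  set w : ℝ → ℝ := fun x => v (projIcc (-δ) δ hle x) with hw
  have hwc : Continuous w := by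
    have := (continuousOn_iff_continuous_domRestrict.1 (hvcont.mono hδI))
    exact this.comp continuous_projIcc
  have hcne : (Icc (-δ) δ).Nonempty := ⟨0, by simp; linarith⟩
  obtain ⟨a, ha, hamin⟩ := isCompact_Icc.exists_isMinOn hcne (hvcont.mono hδI)
  obtain ⟨b, hb, hbmax⟩ := isCompact_Icc.exists_isMaxOn hcne (hvcont.mono hδI)
  have hwv : ∀ x ∈ Icc (-δ) δ, w x = v x := by
    intro x hx
    simp only [hw]
    rw [projIcc_of_mem hle hx]
  have hUu : ∀ x ∈ Icc (-δ) δ, ∫ s in (0:ℝ)..x, w s = u x := by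
    intro x hx
    have h0 : (0:ℝ) ∈ Icc (-δ) δ := by simp; linarith
    have hs : uIcc 0 x ⊆ Icc (-δ) δ := ordConnected_Icc.uIcc_subset h0 hx
    have := intervalIntegral.integral_eq_sub_of_hasDerivAt (a := 0) (b := x) (f := u) (f' := w)
      (fun y hy => by rw [hwv y (hs hy)]; exact hud' y (hδI (hs hy))) (hwc.intervalIntegrable _ _)
    rw [this, hu0, sub_zero]
  refine ⟨fun x => ∫ s in (0:ℝ)..x, w s, w, δ, v a, v b, hδ, hvpos a (hδI ha), hvpos b (hδI hb), hwc,
    fun x => hamin (projIcc (-δ) δ hle x).2, fun x => hbmax (projIcc (-δ) δ hle x).2,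
    fun x => (hwc.integral_hasStrictDerivAt _ _).hasDerivAt, by simp, ?_, ?_⟩
  · rw [hwv 0 (by simp; linarith)]; simp [hv]
  · intro x hx
    have hx' : x ∈ Icc (-δ) δ := abs_le.1 hx
    refine ⟨hδI hx', ?_, ?_⟩
    · simp only [hUu x hx']; exact husq x (hδI hx')
    · simp only [hUu x hx', hwv x hx']; exact huv x (hδI hx')

theorem involution_of_isochronous_center
    (I : Set ℝ) (hIopen : IsOpen I) (hIint : I.OrdConnected) (h0I : (0 : ℝ) ∈ I)
    (g : ℝ → ℝ) (hgcont : ContinuousOn g I) (hg0 : g 0 = 0)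
    (hsign : ∀ x ∈ I, x ≠ 0 → 0 < x * g x)
    (g'0 : ℝ) (hgd : HasDerivAt g g'0 0) (hg'pos : 0 < g'0)
    (ω : ℝ) (hω : ω = Real.sqrt g'0)
    (V : ℝ → ℝ) (hVdef : ∀ x : ℝ, V x = ∫ s in (0 : ℝ)..x, g s)
    (hiso : ∃ ε > 0, ∀ x x' : ℝ → ℝ,
      (∀ t : ℝ, HasDerivAt x (x' t) t) →
      (∀ t : ℝ, HasDerivAt x' (-(g (x t))) t) →
      (∀ t : ℝ, x t ∈ I) →
      x' 0 = 0 → 0 < x 0 → x 0 < ε →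
      ∀ t : ℝ, x (t + 2 * Real.pi / ω) = x t) :
    ∃ J : Set ℝ, ∃ h : ℝ → ℝ, J ⊆ I ∧ IsInvolutionOn h J ∧
      ∀ x ∈ J, V x = ω ^ 2 / 8 * (x - h x) ^ 2 := by
  obtain ⟨ε, hε, hiso⟩ := hiso
  have hωpos : 0 < ω := by rw [hω]; exact sqrt_pos.mpr hg'pos
  obtain ⟨U, w, δ, m, M, hδ, hm, hM, hwc, hmw, hwM, hU, hU0, hw0, hloc⟩ :=
    aux_U I hIopen hIint h0I g hgcont hg0 hsign g'0 hgd hg'pos V hVdef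
  rw [← hω] at hw0
  have hwpos : ∀ x, 0 < w x := fun x => lt_of_lt_of_le hm (hmw x)
  obtain ⟨X, hXU, hUX, hXm, hXd⟩ := aux_inverse U w m hm hU hmw
  have hX0 : X 0 = 0 := by rw [← hU0, hXU, hU0]
  have hXc : Continuous X := continuous_iff_continuousAt.2 fun y => (hXd y).continuousAt
  have hUc : Continuous U := continuous_iff_continuousAt.2 fun y => (hU y).continuousAt
  have hUm : StrictMono U := fun a b hab => by
    by_contra hcon
    push Not at hcon
    have := hXm.monotone hcon
    rw [hXU, hXU] at this
    linarith
  set φ : ℝ → ℝ := fun y => 1 / w (X y) with hφ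
  have hφc : Continuous φ := by
    simp only [hφ]
    exact continuous_const.div (hwc.comp hXc) (fun y => (hwpos _).ne')
  have hφ0 : φ 0 = 1 / ω := by simp [hφ, hX0, hw0]
  have hev : ∀ᶠ y in 𝓝 (0:ℝ), |X y| < δ ∧ X y < ε ∧ 1 / (2 * ω) < φ y := by
    refine Filter.Eventually.and ?_ (Filter.Eventually.and ?_ ?_)
    · exact (hXc.abs.tendsto 0).eventually_lt_const (by simpa [hX0] using hδ)
    · exact (hXc.tendsto 0).eventually_lt_const (by simpa [hX0] using hε)
    · refine (hφc.tendsto 0).eventually_const_lt ?_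
      rw [hφ0]
      apply one_div_lt_one_div_of_lt hωpos; linarith
  obtain ⟨R, hR, hRb⟩ := Metric.eventually_nhds_iff.1 hev
  have hRb' : ∀ y, |y| < R → |X y| < δ ∧ X y < ε ∧ 1 / (2 * ω) < φ y := by
    intro y hy
    exact hRb (by simpa [Real.dist_eq] using hy)
  have hper : ∀ r, 0 ≤ r → r < R →
      ∫ s in (0:ℝ)..π, (φ (r * sin s) + φ (-(r * sin s))) = 2 * π / ω := by
    intro r hr0 hrR
    rcases hr0.eq_or_lt with rfl | hr
    · simp [hφ0]; ring
    · refine aux_period I g ω ε hωpos hiso X φ hφc (1 / M) (by positivity) ?_ hXd hXm hX0 r hr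
        ?_ ?_ ?_ ?_
      · intro y
        exact one_div_le_one_div_of_le (hwpos _) (hwM _)
      · intro y hy
        exact (hloc _ (hRb' y (by linarith)).1.le).1
      · intro y hy
        have := (hloc _ (hRb' y (by linarith)).1.le).2.2
        rw [← this, hUX]
        simp [hφ]
      · exact (hRb' r (by rwa [abs_of_pos hr])).2.1
      · intro y hy
        exact (hRb' y (by linarith)).2.2
  have hmain : ∀ ρ, 0 ≤ ρ → ρ < R → X ρ - X (-ρ) = 2 * ρ / ω := by
    intro ρ hρ0 hρR
    have hd : ∀ y, HasDerivAt (fun y => X y - X (-y) - 2 / ω * y) (φ y + φ (-y) - 2 / ω) y := by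
      intro y
      have h1 := ((hXd y).sub ((hXd (-y)).scomp y (hasDerivAt_neg y))).sub
        ((hasDerivAt_id y).const_mul (2 / ω))
      have e : φ y + φ (-y) - 2 / ω =
          1 / w (X y) - (-1 : ℝ) • (1 / w (X (-y))) - 2 / ω * 1 := by
        simp only [hφ, smul_eq_mul]; ring
      rw [e]
      exact h1
    have hcc : Continuous (fun y => φ y + φ (-y) - 2 / ω) := by fun_prop
    have h2 := aux_abel (fun y => φ y + φ (-y) - 2 / ω) hcc ρ hρ0 (by
      intro r hr0 hr
      rw [intervalIntegral.integral_sub (Continuous.intervalIntegrable (by fun_prop) _ _)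
        (Continuous.intervalIntegrable (by fun_prop) _ _), hper r hr0 (by linarith)]
      simp; ring)
    rw [intervalIntegral.integral_eq_sub_of_hasDerivAt (fun y _ => hd y)
      (hcc.intervalIntegrable _ _)] at h2
    simp only [neg_zero, hX0] at h2
    have : 2 * ρ / ω = 2 / ω * ρ := by ring
    rw [this]; linarith
  have hmain' : ∀ ρ, |ρ| < R → X ρ - X (-ρ) = 2 * ρ / ω := by
    intro ρ hρ
    rcases le_total 0 ρ with h | h
    · exact hmain ρ h (by rwa [abs_of_nonneg h] at hρ)
    · have := hmain (-ρ) (by linarith) (by rwa [abs_of_nonpos h] at hρ)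
      rw [neg_neg] at this
      have e : 2 * -ρ / ω = -(2 * ρ / ω) := by ring
      rw [e] at this; linarith
  have hUC : ContDiff ℝ 1 U := by
    rw [contDiff_one_iff_deriv]
    refine ⟨fun x => (hU x).differentiableAt, ?_⟩
    rwa [show deriv U = w from funext fun x => (hU x).deriv]
  have hXC : ContDiff ℝ 1 X := by
    rw [contDiff_one_iff_deriv]
    refine ⟨fun x => (hXd x).differentiableAt, ?_⟩
    rwa [show deriv X = φ from funext fun x => (hXd x).deriv]
  have hinv : ∀ x, X (-U (X (-U x))) = x := fun x => by rw [hUX, neg_neg, hXU]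
  have hmaps : MapsTo (fun x => X (-U x)) (U ⁻¹' Ioo (-R) R) (U ⁻¹' Ioo (-R) R) := by
    intro x hx
    simp only [mem_preimage, hUX, mem_Ioo] at hx ⊢
    constructor <;> linarith [hx.1, hx.2]
  have hJ : ∀ x ∈ U ⁻¹' Ioo (-R) R, |x| ≤ δ := by
    intro x hx
    have := (hRb' (U x) (abs_lt.2 hx)).1
    rw [hXU] at this
    exact this.le
  refine ⟨U ⁻¹' Ioo (-R) R, fun x => X (-U x), fun x hx => (hloc x (hJ x hx)).1,
    ⟨isOpen_Ioo.preimage hUc, ordConnected_Ioo.preimage_mono hUm.monotone, ?_, ?_, ?_, ?_, ?_, ?_⟩, ?_⟩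
  · simp [hU0, hR]
  · exact Set.InvOn.bijOn ⟨fun x _ => hinv x, fun x _ => hinv x⟩ hmaps hmaps
  · exact (hXC.comp hUC.neg).contDiffOn
  · intro x _; exact hinv x
  · simp [hU0, hX0]
  · have h1 := (hXd (-U 0)).comp (0:ℝ) (hU 0).neg
    simp only [hU0, neg_zero, hX0, hw0] at h1
    have e : 1 / ω * -ω = -1 := by field_simp
    rw [e] at h1
    exact h1
  · intro x hx
    have h1 := hmain' (U x) (abs_lt.2 hx)
    rw [hXU] at h1
    have h2 := (hloc x (hJ x hx)).2.1
    simp only [h1]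
    field_simp
    linarith
end

section
/- Let a > 0, ω > 0, and define V(x) = (ω²/8)·x²·((2 + a·x)/(1 + a·x))² on J = (−1/a, +∞). Then every twice differentiable function x : ℝ → ℝ satisfying x″(t) = −V′(x(t)) for all t ∈ ℝ and x(t) ∈ J for all t ∈ ℝ is periodic with period 2π/ω, i.e. x(t + 2π/ω) = x(t) for all t ∈ ℝ. -/
/-- for `a > 0`, `ω > 0`, and the rational potential
`V x = (ω²/8) x² ((2 + a x)/(1 + a x))²` on `J = (-1/a, +∞)`, every twice
differentiable solution of `ẍ = -V'(x)` staying in `J` is periodic with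
period `2π/ω`. -/
theorem rational_potential_isochronous
    (a ω : ℝ) (ha : 0 < a) (hω : 0 < ω)
    (V : ℝ → ℝ)
    (hV : ∀ y ∈ Set.Ioi (-1 / a),
      V y = ω ^ 2 / 8 * y ^ 2 * ((2 + a * y) / (1 + a * y)) ^ 2)
    (x x' : ℝ → ℝ)
    (hx : ∀ t : ℝ, HasDerivAt x (x' t) t)
    (hx' : ∀ t : ℝ, HasDerivAt x' (-(deriv V (x t))) t)
    (hxJ : ∀ t : ℝ, x t ∈ Set.Ioi (-1 / a)) :
    ∀ t : ℝ, x (t + 2 * Real.pi / ω) = x t := by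
  have hu : ∀ t, 0 < 1 + a * x t := by
    intro t
    have h := hxJ t
    rw [Set.mem_Ioi, div_lt_iff₀ ha] at h
    linarith
  have hdV : ∀ t, deriv V (x t)
      = ω ^ 2 / (4 * a) * ((1 + a * x t) - 1 / (1 + a * x t) ^ 3) := by
    intro t
    have hne := (hu t).ne'
    have hev : V =ᶠ[nhds (x t)]
        fun y => ω ^ 2 / 8 * y ^ 2 * ((2 + a * y) / (1 + a * y)) ^ 2 := by
      filter_upwards [isOpen_Ioi.mem_nhds (hxJ t)] with y hy using hV y hy
    rw [hev.deriv_eq]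
    have h1 : HasDerivAt (fun y : ℝ => 2 + a * y) a (x t) := by
      simpa using ((hasDerivAt_id (x t)).const_mul a).const_add 2
    have h2 : HasDerivAt (fun y : ℝ => 1 + a * y) a (x t) := by
      simpa using ((hasDerivAt_id (x t)).const_mul a).const_add 1
    have h3 := (((hasDerivAt_id (x t)).pow 2).const_mul (ω ^ 2 / 8)).mul ((h1.div h2 hne).pow 2)
    refine HasDerivAt.deriv (h3.congr_deriv ?_)
    simp
    field_simp
    ring
  have hU : ∀ t, HasDerivAt (fun t => 1 + a * x t) (a * x' t) t := fun t =>
    ((hx t).const_mul a).const_add 1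
  have hK : ∀ t, HasDerivAt (fun t => 2 * (a * x' t) ^ 2
      + ω ^ 2 / 2 * ((1 + a * x t) ^ 2 + ((1 + a * x t) ^ 2)⁻¹)) 0 t := by
    intro t
    have hne := (hu t).ne'
    have h1 := ((((hx' t).const_mul a).pow 2).const_mul 2).add
      ((((hU t).pow 2).add (((hU t).pow 2).inv (pow_ne_zero 2 hne))).const_mul (ω ^ 2 / 2))
    refine h1.congr_deriv ?_
    rw [hdV]
    simp
    field_simp
    ring
  obtain ⟨K, hKc⟩ : ∃ K, ∀ t, 2 * (a * x' t) ^ 2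
      + ω ^ 2 / 2 * ((1 + a * x t) ^ 2 + ((1 + a * x t) ^ 2)⁻¹) = K :=
    ⟨_, fun t => is_const_of_deriv_eq_zero (fun s => (hK s).differentiableAt)
      (fun s => (hK s).deriv) t 0⟩
  obtain ⟨z, hz⟩ : ∃ z : ℝ → ℝ, z = fun t => (1 + a * x t) ^ 2 - K / ω ^ 2 := ⟨_, rfl⟩
  obtain ⟨p, hp⟩ : ∃ p : ℝ → ℝ, p = fun t => 2 * ((1 + a * x t) * (a * x' t)) := ⟨_, rfl⟩
  have hz' : ∀ t, HasDerivAt z (p t) t := by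
    intro t
    rw [hz, hp]
    refine (((hU t).pow 2).sub_const _).congr_deriv ?_
    simp
    ring
  have hp' : ∀ t, HasDerivAt p (-(ω ^ 2 * z t)) t := by
    intro t
    have hne := (hu t).ne'
    rw [hz, hp]
    refine (((hU t).mul ((hx' t).const_mul a)).const_mul 2).congr_deriv ?_
    rw [hdV]
    simp only [← hKc t]
    field_simp
    ring
  have hl : ∀ t, HasDerivAt (fun t : ℝ => ω * t) ω t := fun t => by
    simpa using (hasDerivAt_id t).const_mul ω
  have hF : ∀ t, HasDerivAt (fun t => z t * Real.cos (ω * t) - p t / ω * Real.sin (ω * t)) 0 t := by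
    intro t
    refine (((hz' t).mul (hl t).cos).sub (((hp' t).div_const ω).mul (hl t).sin)).congr_deriv ?_
    field_simp
    ring
  have hG : ∀ t, HasDerivAt (fun t => z t * Real.sin (ω * t) + p t / ω * Real.cos (ω * t)) 0 t := by
    intro t
    refine (((hz' t).mul (hl t).sin).add (((hp' t).div_const ω).mul (hl t).cos)).congr_deriv ?_
    field_simp
    ring
  intro t
  have e : ω * (t + 2 * Real.pi / ω) = ω * t + 2 * Real.pi := by field_simp
  have f1 := is_const_of_deriv_eq_zero (fun s => (hF s).differentiableAt)
    (fun s => (hF s).deriv) (t + 2 * Real.pi / ω) t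
  have g1 := is_const_of_deriv_eq_zero (fun s => (hG s).differentiableAt)
    (fun s => (hG s).deriv) (t + 2 * Real.pi / ω) t
  simp only [e, Real.cos_add_two_pi, Real.sin_add_two_pi] at f1 g1
  have hzz : z (t + 2 * Real.pi / ω) = z t := by
    have := Real.sin_sq_add_cos_sq (ω * t)
    linear_combination Real.cos (ω * t) * f1 + Real.sin (ω * t) * g1
      - (z (t + 2 * Real.pi / ω) - z t) * this
  simp only [hz] at hzz
  have hsq : (1 + a * x (t + 2 * Real.pi / ω)) ^ 2 = (1 + a * x t) ^ 2 := by linarith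
  have h := (pow_left_inj₀ (hu _).le (hu t).le two_ne_zero).1 hsq
  exact mul_left_cancel₀ ha.ne' (add_left_cancel h)
end

section
/- Let h : J → J be an involution on an open interval J ⊆ ℝ. Then h is strictly decreasing on J, and x·h(x) < 0 for every x ∈ J with x ≠ 0 (i.e. x and h(x) have opposite signs). In particular, 0 is the only fixed point of h in J. -/
/-- an involution `h` on an open interval `J` is strictly
decreasing on `J`, satisfies `x · h x < 0` for every `x ∈ J` with `x ≠ 0`
(i.e. `x` and `h x` have opposite signs), and `0` is its only fixed point
in `J`. -/
theorem involution_strictAnti_opposite_signs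
    (J : Set ℝ) (h : ℝ → ℝ) (hinv : IsInvolutionOn h J) :
    StrictAntiOn h J ∧
    (∀ x ∈ J, x ≠ 0 → x * h x < 0) ∧
    (∀ x ∈ J, h x = x → x = 0) := by
  obtain ⟨hopen, hconn, h0, hbij, hcd, hhh, hz, hd⟩ := hinv
  have hanti : StrictAntiOn h J := by
    intro a ha b hb hab
    have hm : min a 0 ∈ J := by rcases min_choice a 0 with e | e <;> rw [e] <;> assumption
    have hM : max b 0 ∈ J := by rcases max_choice b 0 with e | e <;> rw [e] <;> assumption
    obtain ⟨s, hs, hsJ⟩ := Filter.Eventually.exists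
      ((eventually_mem_nhdsWithin (a := min a 0) (s := Set.Iio (min a 0))).and
        (nhdsWithin_le_nhds (hopen.mem_nhds hm)))
    obtain ⟨t, ht, htJ⟩ := Filter.Eventually.exists
      ((eventually_mem_nhdsWithin (a := max b 0) (s := Set.Ioi (max b 0))).and
        (nhdsWithin_le_nhds (hopen.mem_nhds hM)))
    obtain ⟨hsa, hs0⟩ := lt_min_iff.1 (Set.mem_Iio.1 hs)
    obtain ⟨hbt, h0t⟩ := max_lt_iff.1 (Set.mem_Ioi.1 ht)
    have hsub : Set.Icc s t ⊆ J := hconn.out hsJ htJ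
    rcases ContinuousOn.strictMonoOn_of_injOn_Icc' (hs0.trans h0t).le
      (hcd.continuousOn.mono hsub) (hbij.injOn.mono hsub) with hmono | han
    · exfalso
      have h1 : 0 ≤ derivWithin h (Set.Icc s t) 0 := hmono.monotoneOn.derivWithin_nonneg
      rw [hd.hasDerivWithinAt.derivWithin
        (uniqueDiffOn_Icc (hs0.trans h0t) 0 ⟨hs0.le, h0t.le⟩)] at h1
      linarith
    · exact han ⟨hsa.le, by linarith⟩ ⟨by linarith, hbt.le⟩ hab
  have hsign : ∀ x ∈ J, x ≠ 0 → x * h x < 0 := by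
    intro x hx hx0
    rcases lt_or_gt_of_ne hx0 with hlt | hgt
    · have := hanti hx h0 hlt
      rw [hz] at this
      exact mul_neg_of_neg_of_pos hlt this
    · have := hanti h0 hx hgt
      rw [hz] at this
      exact mul_neg_of_pos_of_neg hgt this
  refine ⟨hanti, hsign, fun x hx hfix => ?_⟩
  by_contra hne
  have := hsign x hx hne
  rw [hfix] at this
  exact absurd this (not_lt.2 (mul_self_nonneg x))
end

section
/- Let h : J → J be an involution on an open interval J ⊆ ℝ, let ω > 0, and define V(x) = (ω²/8)·(x − h(x))². Then V(x) ≥ (ω²/8)·x² for all x ∈ J. -/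
/-- global inequality for isochronous potentials: if `h` is an
involution on `J`, `ω > 0`, and `V x = (ω²/8)(x - h x)²`, then
`V x ≥ (ω²/8) x²` on `J`. -/
theorem isochronous_potential_global_inequality
    (J : Set ℝ) (h : ℝ → ℝ) (hinv : IsInvolutionOn h J)
    (ω : ℝ) (hω : 0 < ω)
    (V : ℝ → ℝ) (hV : ∀ y ∈ J, V y = ω ^ 2 / 8 * (y - h y) ^ 2) :
    ∀ x ∈ J, ω ^ 2 / 8 * x ^ 2 ≤ V x := by
  obtain ⟨-, hc, h0J, hb, hd, -, h0, hder⟩ := hinv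
  intro x hx
  have key : x * h x ≤ 0 := by
    have hs := (hasDerivAt_iff_tendsto_slope.mp hder).eventually
      (gt_mem_nhds (show (-1 : ℝ) < 0 by norm_num))
    by_contra! hpos
    rcases lt_trichotomy x 0 with hx0 | hx0 | hx0
    · have hhx : h x < 0 := by nlinarith
      have hsub : Set.Icc x 0 ⊆ J := hc.out hx h0J
      have hm := ContinuousOn.strictMonoOn_of_injOn_Icc (f := h) hx0.le (by rw [h0]; exact hhx.le)
        (hd.continuousOn.mono hsub) (hb.injOn.mono hsub)
      have h1 := hs.filter_mono
        (nhdsWithin_mono (0 : ℝ) (show Set.Iio (0 : ℝ) ⊆ {0}ᶜ from fun y hy => ne_of_lt hy))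
      obtain ⟨y, hy1, hy2⟩ := (h1.and (Ioo_mem_nhdsLT hx0)).exists
      have h2 := hm ⟨hy2.1.le, hy2.2.le⟩ ⟨hx0.le, le_rfl⟩ hy2.2
      rw [h0] at h2
      rw [slope_def_field, h0, sub_zero, sub_zero] at hy1
      exact absurd hy1 (not_lt.mpr (div_pos_of_neg_of_neg h2 hy2.2).le)
    · simp [hx0] at hpos
    · have hhx : 0 < h x := by nlinarith
      have hsub : Set.Icc 0 x ⊆ J := hc.out h0J hx
      have hm := ContinuousOn.strictMonoOn_of_injOn_Icc (f := h) hx0.le (by rw [h0]; exact hhx.le)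
        (hd.continuousOn.mono hsub) (hb.injOn.mono hsub)
      have h1 := hs.filter_mono
        (nhdsWithin_mono (0 : ℝ) (show Set.Ioi (0 : ℝ) ⊆ {0}ᶜ from fun y hy => ne_of_gt hy))
      obtain ⟨y, hy1, hy2⟩ := (h1.and (Ioo_mem_nhdsGT hx0)).exists
      have h2 := hm ⟨le_rfl, hx0.le⟩ ⟨hy2.1.le, hy2.2.le⟩ hy2.1
      rw [h0] at h2
      rw [slope_def_field, h0, sub_zero, sub_zero] at hy1
      exact absurd hy1 (not_lt.mpr (div_pos h2 hy2.1).le)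
  rw [hV x hx]
  apply mul_le_mul_of_nonneg_left _ (by positivity)
  nlinarith [sq_nonneg (h x)]
end

section
/- Let f : ℝ² → ℝ be a C¹ function with f(0,0) = 0 and f(x,y) = f(y,x) for all (x,y) ∈ ℝ². Suppose the zero set Γ = f⁻¹({0}) is connected, that ∂f/∂y (x,y) ≠ 0 for every (x,y) ∈ Γ, and that Γ projects onto the whole x-axis, i.e. for every x ∈ ℝ there exists y ∈ ℝ with (x,y) ∈ Γ. Then there exists a global involution h : ℝ → ℝ whose graph equals Γ: h is C¹, strictly decreasing with h′(x) < 0 for all x ∈ ℝ, h(h(x)) = x for all x ∈ ℝ, h(0) = 0, h′(0) = −1, and Γ = {(x, h(x)) : x ∈ ℝ}. -/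
open Set Filter Topology

theorem aux_unique_lt (g : ℝ → ℝ) (hg : Differentiable ℝ g)
    (hpos : ∀ t, g t = 0 → 0 < deriv g t) (a b : ℝ) (hab : a < b)
    (ha : g a = 0) (hb : g b = 0) : False := by
  have h0 : ∀ ⦃x⦄, x ∈ Icc a b → (fun _ : ℝ => (0:ℝ)) x ≤ g x :=
    image_le_of_deriv_right_lt_deriv_boundary' (f' := fun _ => 0) (B' := deriv g)
      continuousOn_const (fun x _ => hasDerivWithinAt_const _ _ _) (by simp [ha])
      hg.continuous.continuousOn (fun x _ => (hg x).hasDerivAt.hasDerivWithinAt)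
      (fun x _ hx => hpos x hx.symm)
  have h1 := eventually_nhdsWithin_sign_eq_of_deriv_pos (hpos b hb) hb
  have h2 : ∀ᶠ x in 𝓝 b, a < x := lt_mem_nhds hab
  have h3 : ∀ᶠ x in 𝓝[<] b, x < b := self_mem_nhdsWithin
  have h4 := (h3.and ((h1.and h2).filter_mono nhdsWithin_le_nhds)).exists
  obtain ⟨x, hxb, hs, hax⟩ := h4
  have h5 := h0 ⟨hax.le, hxb.le⟩
  have h6 : SignType.sign (x - b) = -1 := sign_eq_neg_one_iff.2 (by linarith)
  rw [h6, sign_eq_neg_one_iff] at hs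
  simp only at h5
  linarith

theorem aux_unique (g : ℝ → ℝ) (hg : Differentiable ℝ g)
    (hpos : ∀ t, g t = 0 → 0 < deriv g t) (a b : ℝ)
    (ha : g a = 0) (hb : g b = 0) : a = b := by
  rcases lt_trichotomy a b with h | h | h
  · exact (aux_unique_lt g hg hpos a b h ha hb).elim
  · exact h
  · exact (aux_unique_lt g hg hpos b a h hb ha).elim

theorem aux_snd (f : ℝ → ℝ → ℝ) (hC1 : ContDiff ℝ 1 (fun p : ℝ × ℝ => f p.1 p.2)) (x y : ℝ) :
    HasDerivAt (f x) (fderiv ℝ (fun p : ℝ × ℝ => f p.1 p.2) (x, y) (0, 1)) y := by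
  have h1 := ((hC1.differentiable one_ne_zero) (x, y)).hasFDerivAt
  have h2 : HasDerivAt (fun t : ℝ => (x, t)) ((0:ℝ), (1:ℝ)) y :=
    (hasDerivAt_const y x).prodMk (hasDerivAt_id y)
  exact h1.comp_hasDerivAt y h2

theorem aux_pos
    (f : ℝ → ℝ → ℝ)
    (hC1 : ContDiff ℝ 1 (fun p : ℝ × ℝ => f p.1 p.2))
    (hf00 : f 0 0 = 0)
    (hsymm : ∀ x y : ℝ, f y x = f x y)
    (hd2 : ∀ p : ℝ × ℝ, f p.1 p.2 = 0 → 0 < deriv (f p.1) p.2)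
    (hproj : ∀ x : ℝ, ∃ y : ℝ, f x y = 0) :
    ∃ h : ℝ → ℝ, ContDiff ℝ 1 h ∧ (∀ x : ℝ, deriv h x < 0) ∧ StrictAnti h ∧
      (∀ x : ℝ, h (h x) = x) ∧ h 0 = 0 ∧ deriv h 0 = -1 ∧
      {p : ℝ × ℝ | f p.1 p.2 = 0} = {p : ℝ × ℝ | p.2 = h p.1} := by
  have huniq : ∀ x a b, f x a = 0 → f x b = 0 → a = b := fun x a b =>
    aux_unique (f x) (fun y => (aux_snd f hC1 x y).differentiableAt)
      (fun t ht => hd2 (x, t) ht) a b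
  choose h hh using hproj
  have hh0 : h 0 = 0 := huniq 0 _ _ (hh 0) hf00
  have hcd : ContDiff ℝ 1 h := by
    rw [contDiff_iff_contDiffAt]
    intro x
    have cdf : ContDiffAt ℝ 1 (fun p : ℝ × ℝ => f p.1 p.2) (x, h x) := hC1.contDiffAt
    have hne : fderiv ℝ (fun p : ℝ × ℝ => f p.1 p.2) (x, h x) (0, 1) ≠ 0 := by
      rw [← (aux_snd f hC1 x (h x)).deriv]
      exact (hd2 (x, h x) (hh x)).ne'
    have hinv : (fderiv ℝ (fun p : ℝ × ℝ => f p.1 p.2) (x, h x) ∘L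
        .inr ℝ ℝ ℝ).IsInvertible := by
      refine ⟨ContinuousLinearEquiv.unitsEquivAut ℝ (Units.mk0 _ hne), ?_⟩
      ext
      simp
    refine (cdf.contDiffAt_implicitFunction one_ne_zero hinv).congr_of_eventuallyEq ?_
    filter_upwards [cdf.eventually_apply_implicitFunction one_ne_zero hinv] with t ht
    refine huniq t _ _ (hh t) ?_
    simp only [hh x] at ht
    exact ht
  have key : ∀ x, deriv (f (h x)) x + deriv h x * deriv (f x) (h x) = 0 := by
    intro x
    have h1 := ((hC1.differentiable one_ne_zero) (x, h x)).hasFDerivAt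
    have h2 : HasDerivAt (fun t : ℝ => (t, h t)) ((1:ℝ), deriv h x) x :=
      (hasDerivAt_id x).prodMk ((hcd.differentiable one_ne_zero) x).hasDerivAt
    have h3 := h1.comp_hasDerivAt x h2
    have h4 : ((fun p : ℝ × ℝ => f p.1 p.2) ∘ fun t : ℝ => (t, h t)) = fun _ => 0 := by
      funext t
      exact hh t
    rw [h4] at h3
    have h5 := h3.unique (hasDerivAt_const x 0)
    have h6 : HasDerivAt (fun t : ℝ => (t, h x)) ((1:ℝ), (0:ℝ)) x :=
      (hasDerivAt_id x).prodMk (hasDerivAt_const x (h x))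
    have h7 := h1.comp_hasDerivAt x h6
    have h8 : ((fun p : ℝ × ℝ => f p.1 p.2) ∘ fun t : ℝ => (t, h x)) = f (h x) := by
      funext t
      exact hsymm _ _
    rw [h8] at h7
    rw [h7.deriv, (aux_snd f hC1 x (h x)).deriv, ← smul_eq_mul, ← map_smul, ← map_add]
    simpa using h5
  have hneg : ∀ x, deriv h x < 0 := by
    intro x
    have h1 := hd2 (x, h x) (hh x)
    have h2 := hd2 (h x, x) (by rw [hsymm]; exact hh x)
    simp only at h1 h2
    have h3 := key x
    by_contra hc
    have := mul_nonneg (not_lt.1 hc) h1.le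
    linarith
  refine ⟨h, hcd, hneg, strictAnti_of_deriv_neg hneg, ?_, hh0, ?_, ?_⟩
  · intro x
    exact huniq (h x) _ _ (hh (h x)) (by rw [hsymm]; exact hh x)
  · have h1 := key 0
    have h2 := hd2 (0, 0) hf00
    simp only [hh0] at h1 h2
    have h3 : (1 + deriv h 0) * deriv (f 0) 0 = 0 := by linarith
    rcases mul_eq_zero.1 h3 with h4 | h4
    · linarith
    · exact absurd h4 h2.ne'
  · ext ⟨x, y⟩
    simp only [mem_setOf_eq]
    constructor
    · intro hy
      exact huniq x _ _ hy (hh x)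
    · rintro rfl
      exact hh x

/-- if `f : ℝ² → ℝ` is C¹, `f 0 0 = 0`, `f` is symmetric, its zero
set `Γ` is connected, `∂f/∂y ≠ 0` on `Γ`, and `Γ` projects onto the whole
`x`-axis, then `Γ` is the graph of a global involution `h : ℝ → ℝ`: `h` is C¹,
strictly decreasing with `h' x < 0` everywhere, `h (h x) = x`, `h 0 = 0`, and
`h' 0 = -1`. -/
theorem global_involution_from_symmetric_zero_set
    (f : ℝ → ℝ → ℝ)
    (hC1 : ContDiff ℝ 1 (fun p : ℝ × ℝ => f p.1 p.2))
    (hf00 : f 0 0 = 0)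
    (hsymm : ∀ x y : ℝ, f y x = f x y)
    (hconn : IsConnected {p : ℝ × ℝ | f p.1 p.2 = 0})
    (hd2 : ∀ p : ℝ × ℝ, f p.1 p.2 = 0 → deriv (f p.1) p.2 ≠ 0)
    (hproj : ∀ x : ℝ, ∃ y : ℝ, f x y = 0) :
    ∃ h : ℝ → ℝ, ContDiff ℝ 1 h ∧ (∀ x : ℝ, deriv h x < 0) ∧ StrictAnti h ∧
      (∀ x : ℝ, h (h x) = x) ∧ h 0 = 0 ∧ deriv h 0 = -1 ∧
      {p : ℝ × ℝ | f p.1 p.2 = 0} = {p : ℝ × ℝ | p.2 = h p.1} := by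
  have hcont : Continuous (fun p : ℝ × ℝ => deriv (f p.1) p.2) := by
    have h1 : (fun p : ℝ × ℝ => deriv (f p.1) p.2) =
        fun p => fderiv ℝ (fun p : ℝ × ℝ => f p.1 p.2) p (0, 1) := by
      funext p
      exact (aux_snd f hC1 p.1 p.2).deriv
    rw [h1]
    exact (hC1.continuous_fderiv one_ne_zero).clm_apply continuous_const
  have hord := (hconn.isPreconnected.image _ hcont.continuousOn).ordConnected
  have hn0 : (0:ℝ) ∉ (fun p : ℝ × ℝ => deriv (f p.1) p.2) '' {p : ℝ × ℝ | f p.1 p.2 = 0} := by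
    rintro ⟨p, hp, hp0⟩
    exact hd2 p hp hp0
  rcases lt_or_gt_of_ne (hd2 (0, 0) hf00) with hs | hs
  · have hall : ∀ p : ℝ × ℝ, f p.1 p.2 = 0 → deriv (f p.1) p.2 < 0 := by
      intro p hp
      by_contra hc
      exact hn0 (hord.out (mem_image_of_mem _ (show ((0:ℝ),(0:ℝ)) ∈ _ from hf00))
        (mem_image_of_mem _ (show p ∈ _ from hp)) ⟨hs.le, not_lt.1 hc⟩)
    have := aux_pos (fun x y => - f x y) hC1.neg (by simp [hf00])
      (fun x y => by simp [hsymm x y])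
      (fun p hp => by
        have h1 := hall p (by simpa using hp)
        have h2 : deriv (fun y => - f p.1 y) p.2 = - deriv (f p.1) p.2 := deriv.fun_neg
        show 0 < deriv (fun y => - f p.1 y) p.2
        rw [h2]
        linarith)
      (fun x => by simpa using hproj x)
    simpa only [neg_eq_zero] using this
  · have hall : ∀ p : ℝ × ℝ, f p.1 p.2 = 0 → 0 < deriv (f p.1) p.2 := by
      intro p hp
      by_contra hc
      exact hn0 (hord.out (mem_image_of_mem _ (show p ∈ _ from hp))
        (mem_image_of_mem _ (show ((0:ℝ),(0:ℝ)) ∈ _ from hf00)) ⟨not_lt.1 hc, hs.le⟩)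
    exact aux_pos f hC1 hf00 hsymm hall hproj
end

section
/- Let h : ℝ → ℝ be a global involution and define f(x,y) = x + y − h(x) − h(y). Then f is C¹ on ℝ², f(0,0) = 0, f(x,y) = f(y,x) for all (x,y), ∂f/∂y (x,y) = 1 − h′(y) > 0 for all (x,y) ∈ ℝ², and the zero set of f coincides with the graph of h: {(x,y) ∈ ℝ² : x + y = h(x) + h(y)} = {(x, h(x)) : x ∈ ℝ}. -/
/-- A global involution: a C¹ diffeomorphism `h` of `ℝ` onto itself such that
`h ∘ h` is the identity, `h 0 = 0`, and `h' 0 = -1`. -/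
def GlobalInvolution (h : ℝ → ℝ) : Prop :=
  ContDiff ℝ 1 h ∧ Function.Bijective h ∧
  (∀ x : ℝ, h (h x) = x) ∧ h 0 = 0 ∧ HasDerivAt h (-1) 0

/-- for a global involution `h`, the function
`f (x, y) = x + y - h x - h y` is C¹ on `ℝ²`, vanishes at the origin, is
symmetric, has `∂f/∂y (x, y) = 1 - h' y > 0` everywhere, and its zero set is
exactly the graph of `h`. -/
theorem symmetric_function_from_global_involution
    (h : ℝ → ℝ) (hinv : GlobalInvolution h) :
    ContDiff ℝ 1 (fun p : ℝ × ℝ => p.1 + p.2 - h p.1 - h p.2) ∧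
    ((0 : ℝ) + 0 - h 0 - h 0 = 0) ∧
    (∀ x y : ℝ, x + y - h x - h y = y + x - h y - h x) ∧
    (∀ x y : ℝ, HasDerivAt (fun z : ℝ => x + z - h x - h z) (1 - deriv h y) y ∧
      0 < 1 - deriv h y) ∧
    {p : ℝ × ℝ | p.1 + p.2 - h p.1 - h p.2 = 0} = {p : ℝ × ℝ | p.2 = h p.1} := by
  obtain ⟨hc, -, hh, h0, hd⟩ := hinv
  have hdiff : Differentiable ℝ h := hc.differentiable (by norm_num)
  have hcont : Continuous (deriv h) := hc.continuous_deriv (by norm_num)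
  have hne : ∀ y, deriv h y ≠ 0 := by
    intro y hy
    have h1 : HasDerivAt (h ∘ h) (deriv h (h y) * deriv h y) y :=
      (hdiff (h y)).hasDerivAt.comp y (hdiff y).hasDerivAt
    have h2 : h ∘ h = id := funext hh
    rw [h2] at h1
    have := h1.unique (hasDerivAt_id y)
    rw [hy] at this
    norm_num at this
  have hneg : ∀ y, deriv h y < 0 := by
    intro y
    by_contra hy
    obtain ⟨z, hz⟩ := mem_range_of_exists_le_of_exists_ge hcont
      ⟨0, by rw [hd.deriv]; norm_num⟩ ⟨y, not_lt.mp hy⟩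
    exact hne z hz
  have hanti : StrictAnti h := strictAnti_of_deriv_neg hneg
  refine ⟨?_, by simp [h0], fun x y => by ring, fun x y => ⟨?_, by linarith [hneg y]⟩, ?_⟩
  · exact ((contDiff_fst.add contDiff_snd).sub (hc.comp contDiff_fst)).sub
      (hc.comp contDiff_snd)
  · exact (((hasDerivAt_id y).const_add x).sub_const (h x)).sub (hdiff y).hasDerivAt
  · ext ⟨x, y⟩
    simp only [Set.mem_setOf_eq]
    constructor
    · intro e
      rcases lt_trichotomy y (h x) with l | l | l
      · have := hanti l
        rw [hh] at this
        linarith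
      · exact l
      · have := hanti l
        rw [hh] at this
        linarith
    · rintro rfl
      rw [hh]
      ring
end

section
/- The polynomial 1 − 2x + 5x⁴ is strictly positive for every x ∈ ℝ; consequently the map φ(x) = x − x² + x⁵ is a strictly increasing bijection of ℝ onto ℝ, and there exists a unique global involution h : ℝ → ℝ such that x − x² + x⁵ + h(x) − h(x)² + h(x)⁵ = 0 for all x ∈ ℝ. -/
/-- `1 - 2x + 5x⁴ > 0` for all real `x`, hence
`φ x = x - x² + x⁵` is a strictly increasing bijection of `ℝ` onto itself,
and there exists a unique global involution `h` with
`x - x² + x⁵ + h x - (h x)² + (h x)⁵ = 0` for all `x`. -/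
theorem implicit_quintic_global_involution :
    (∀ x : ℝ, 0 < 1 - 2 * x + 5 * x ^ 4) ∧
    StrictMono (fun x : ℝ => x - x ^ 2 + x ^ 5) ∧
    Function.Bijective (fun x : ℝ => x - x ^ 2 + x ^ 5) ∧
    (∃! h : ℝ → ℝ, GlobalInvolution h ∧
      ∀ x : ℝ, x - x ^ 2 + x ^ 5 + h x - (h x) ^ 2 + (h x) ^ 5 = 0) := by
  have hpos : ∀ x : ℝ, 0 < 1 - 2 * x + 5 * x ^ 4 := fun x => by
    nlinarith [sq_nonneg (x ^ 2 - 1/5), sq_nonneg (x - 1/2)]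
  have hd : ∀ x : ℝ, HasDerivAt (fun x : ℝ => x - x ^ 2 + x ^ 5) (1 - 2 * x + 5 * x ^ 4) x := by
    intro x
    have := ((hasDerivAt_id' x).sub (hasDerivAt_pow 2 x)).add (hasDerivAt_pow 5 x)
    have h2 : (1 - 2 * x + 5 * x ^ 4 : ℝ) = 1 - (2:ℕ) * x ^ (2 - 1) + (5:ℕ) * x ^ (5 - 1) := by
      norm_num
    rw [h2]
    exact this
  have hmono : StrictMono (fun x : ℝ => x - x ^ 2 + x ^ 5) :=
    strictMono_of_deriv_pos fun x => by rw [(hd x).deriv]; exact hpos x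
  have hq : ∀ x : ℝ, 3/10 ≤ 1 - x + x ^ 4 := fun x => by
    nlinarith [sq_nonneg (x ^ 2 - 2/5), sq_nonneg (x - 5/8)]
  have hcont : Continuous (fun x : ℝ => x - x ^ 2 + x ^ 5) := by fun_prop
  have hsurj : Function.Surjective (fun x : ℝ => x - x ^ 2 + x ^ 5) := by
    intro y
    have hy := abs_nonneg y
    refine mem_range_of_exists_le_of_exists_ge hcont ⟨-(10/3 * |y|), ?_⟩ ⟨10/3 * |y|, ?_⟩
    · have h1 := mul_le_mul_of_nonneg_left (hq (-(10/3 * |y|))) hy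
      have := neg_abs_le y
      nlinarith
    · have h1 := mul_le_mul_of_nonneg_left (hq (10/3 * |y|)) hy
      have := le_abs_self y
      nlinarith
  refine ⟨hpos, hmono, ⟨hmono.injective, hsurj⟩, ?_⟩
  let e : ℝ ≃ₜ ℝ := (hmono.orderIsoOfSurjective _ hsurj).toHomeomorph
  have he : ∀ x, e x = x - x ^ 2 + x ^ 5 := fun x => rfl
  have hde : ∀ x, HasDerivAt e (1 - 2 * x + 5 * x ^ 4) x := hd
  have hsymm : ContDiff ℝ 1 e.symm := by
    refine e.contDiff_symm_deriv (f' := fun x => 1 - 2 * x + 5 * x ^ 4) (fun x => (hpos x).ne') hde ?_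
    have : (e : ℝ → ℝ) = fun x : ℝ => x - x ^ 2 + x ^ 5 := rfl
    rw [this]
    fun_prop
  have hec : ContDiff ℝ 1 e := by
    have : (e : ℝ → ℝ) = fun x : ℝ => x - x ^ 2 + x ^ 5 := rfl
    rw [this]
    fun_prop
  have hinv : Function.Involutive (fun x => e.symm (-(e x))) := fun x => by simp
  have e0 : e 0 = 0 := by rw [he]; norm_num
  have es0 : e.symm 0 = 0 := by rw [e.symm_apply_eq, e0]
  have hds0 : HasDerivAt e.symm 1 0 := by
    have h1 : HasDerivAt e 1 (e.symm 0) := by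
      rw [es0]; simpa using hde 0
    simpa using HasDerivAt.of_local_left_inverse e.symm.continuous.continuousAt h1 one_ne_zero
      (Filter.Eventually.of_forall fun y => e.apply_symm_apply y)
  refine ⟨fun x => e.symm (-(e x)), ⟨⟨hsymm.comp hec.neg, hinv.bijective, hinv, by simp [e0, es0], ?_⟩, ?_⟩, ?_⟩
  · have h1 : HasDerivAt e 1 0 := by simpa using hde 0
    have h2 : HasDerivAt e.symm 1 (-(e 0)) := by simpa [e0] using hds0
    simpa [Function.comp_def] using h2.comp (0:ℝ) h1.neg
  · intro x
    have h1 := he (e.symm (-(e x)))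
    rw [e.apply_symm_apply, he x] at h1
    dsimp only
    rw [he x]
    linarith
  · rintro g ⟨-, hg⟩
    funext x
    apply e.injective
    simp only [e.apply_symm_apply]
    rw [he, he]
    linarith [hg x]
end

section
/- Let λ > 0 and a ∈ ℝ, and define h(x) = −a − (1/λ)·[(λ + 2a²)·(a + x) − 2a·√(λ + a²)·√(λ + (a + x)²)] for x ∈ ℝ. Then h is a global involution: h is C¹ on ℝ, strictly decreasing, h(h(x)) = x for all x ∈ ℝ, h(0) = 0, and h′(0) = −1. -/
/-- for `λ > 0` and `a ∈ ℝ`, the Stillinger map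
`h x = -a - (1/λ)((λ + 2a²)(a + x) - 2a √(λ + a²) √(λ + (a + x)²))` is a
strictly decreasing global involution. -/
theorem stillinger_global_involution (l a : ℝ) (hl : 0 < l) :
    GlobalInvolution (fun x : ℝ =>
      -a - (1 / l) * ((l + 2 * a ^ 2) * (a + x) -
        2 * a * Real.sqrt (l + a ^ 2) * Real.sqrt (l + (a + x) ^ 2))) ∧
    StrictAnti (fun x : ℝ =>
      -a - (1 / l) * ((l + 2 * a ^ 2) * (a + x) -
        2 * a * Real.sqrt (l + a ^ 2) * Real.sqrt (l + (a + x) ^ 2))) := by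
  have hA0 : 0 < l + a ^ 2 := by positivity
  have hA : Real.sqrt (l + a ^ 2) ^ 2 = l + a ^ 2 := Real.sq_sqrt hA0.le
  have hApos : 0 < Real.sqrt (l + a ^ 2) := Real.sqrt_pos.2 hA0
  have hS : ∀ y : ℝ, Real.sqrt (l + y ^ 2) ^ 2 = l + y ^ 2 :=
    fun y => Real.sq_sqrt (by positivity)
  have hSpos : ∀ y : ℝ, 0 < Real.sqrt (l + y ^ 2) :=
    fun y => Real.sqrt_pos.2 (by positivity)
  have key : ∀ u v : ℝ, u ^ 2 ≤ v ^ 2 → 0 < v →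
      2 * a * Real.sqrt (l + a ^ 2) * u < (l + 2 * a ^ 2) * v := by
    intro u v huv hv
    apply lt_of_pow_lt_pow_left₀ 2 (by positivity)
    have e1 : (2 * a * Real.sqrt (l + a ^ 2) * u) ^ 2 = 4 * a ^ 2 * (l + a ^ 2) * u ^ 2 := by
      linear_combination (4 * a ^ 2 * u ^ 2) * hA
    rw [e1]
    have h1 : 4 * a ^ 2 * (l + a ^ 2) * u ^ 2 ≤ 4 * a ^ 2 * (l + a ^ 2) * v ^ 2 := by gcongr
    have h2 : 0 < l ^ 2 * v ^ 2 := by positivity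
    nlinarith
  have hinv : ∀ x : ℝ, (fun x : ℝ =>
      -a - (1 / l) * ((l + 2 * a ^ 2) * (a + x) -
        2 * a * Real.sqrt (l + a ^ 2) * Real.sqrt (l + (a + x) ^ 2))) ((fun x : ℝ =>
      -a - (1 / l) * ((l + 2 * a ^ 2) * (a + x) -
        2 * a * Real.sqrt (l + a ^ 2) * Real.sqrt (l + (a + x) ^ 2))) x) = x := by
    intro x
    have hTpos := key (a + x) (Real.sqrt (l + (a + x) ^ 2)) (by rw [hS]; linarith) (hSpos _)
    have hSy := hS (a + x)
    beta_reduce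
    generalize hSd : Real.sqrt (l + (a + x) ^ 2) = S at *
    generalize hAd : Real.sqrt (l + a ^ 2) = A at *
    have hT : Real.sqrt (l + (a + (-a - 1 / l * ((l + 2 * a ^ 2) * (a + x) - 2 * a * A * S))) ^ 2)
        = (1 / l) * ((l + 2 * a ^ 2) * S - 2 * a * A * (a + x)) := by
      rw [Real.sqrt_eq_iff_mul_self_eq (by positivity)
        (mul_nonneg (by positivity) (by linarith))]
      field_simp
      have e : (l + 2 * a ^ 2) ^ 2 - 4 * a ^ 2 * A ^ 2 = l ^ 2 := by rw [hA]; ring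
      linear_combination (-((l + 2 * a ^ 2) ^ 2 - 4 * a ^ 2 * A ^ 2)) * hSy - l * e
    rw [hT]
    field_simp
    linear_combination (-4 * a ^ 2 * (a + x)) * hA
  refine ⟨⟨?_, (Function.Involutive.bijective hinv), hinv, ?_, ?_⟩, ?_⟩
  · have : ContDiff ℝ 1 (fun x : ℝ => Real.sqrt (l + (a + x) ^ 2)) :=
      ContDiff.sqrt (by fun_prop) (fun x => by positivity)
    fun_prop
  · simp only [add_zero]
    field_simp
    linear_combination (2 * a) * hA
  · have h1 : HasDerivAt (fun x : ℝ => a + x) 1 0 := (hasDerivAt_id (0:ℝ)).const_add a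
    have h2 : HasDerivAt (fun x : ℝ => Real.sqrt (l + (a + x) ^ 2)) _ 0 :=
      ((h1.pow 2).const_add l).sqrt (by simp; positivity)
    have h3 := (((h1.const_mul (l + 2 * a ^ 2)).sub
      (h2.const_mul (2 * a * Real.sqrt (l + a ^ 2)))).const_mul (1 / l)).const_sub (-a)
    refine h3.congr_deriv ?_
    simp
    field_simp
    ring
  · intro x y hxy
    have hd : (Real.sqrt (l + (a + y) ^ 2) - Real.sqrt (l + (a + x) ^ 2)) ^ 2 ≤ (y - x) ^ 2 := by
      have h1 : l + (a + x) * (a + y) ≤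
          Real.sqrt (l + (a + y) ^ 2) * Real.sqrt (l + (a + x) ^ 2) := by
        apply le_of_abs_le
        apply abs_le_of_sq_le_sq _ (by positivity)
        rw [mul_pow, hS, hS]
        nlinarith [mul_nonneg hl.le (sq_nonneg (x - y))]
      nlinarith [hS (a + x), hS (a + y)]
    have hk := key _ _ hd (by linarith)
    beta_reduce
    have : 0 < 1 / l := by positivity
    apply sub_lt_sub_left
    apply mul_lt_mul_of_pos_left _ this
    linarith
end

section
/- Let β ≠ 0 and define h(x) = (1/β)·ln( 2·e^{βx} / (√(1 + 8·e^{3βx}) − 1) ) for x ∈ ℝ. Then h is a global involution: h is C¹ on ℝ, strictly decreasing, h(h(x)) = x for all x ∈ ℝ, h(0) = 0, and h′(0) = −1. Equivalently, (√(1 + 8·e^{3βx}) − 1)·(√(1 + 8·e^{3β·h(x)}) − 1) = 4 for all x ∈ ℝ. -/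
lemma dor_aux (β x : ℝ) : ∃ s : ℝ, Real.sqrt (1 + 8 * Real.exp (3 * β * x)) = s ∧ 1 < s ∧
    s ^ 2 = 1 + 8 * Real.exp (β * x) ^ 3 := by
  have h3 : Real.exp (3 * β * x) = Real.exp (β * x) ^ 3 := by
    rw [← Real.exp_nat_mul]; congr 1; push_cast; ring
  have hp : 0 < Real.exp (β * x) ^ 3 := by positivity
  refine ⟨_, rfl, ?_, ?_⟩
  · rw [h3]; apply Real.lt_sqrt_of_sq_lt; linarith
  · rw [h3, Real.sq_sqrt (by positivity)]

lemma dor_exp (β : ℝ) (hβ : β ≠ 0) (x : ℝ) :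
    Real.exp (β * ((1 / β) * Real.log (2 * Real.exp (β * x) /
      (Real.sqrt (1 + 8 * Real.exp (3 * β * x)) - 1)))) = 2 * Real.exp (β * x) /
      (Real.sqrt (1 + 8 * Real.exp (3 * β * x)) - 1) := by
  obtain ⟨s, hs, h1, -⟩ := dor_aux β x
  rw [hs, ← mul_assoc, mul_one_div_cancel hβ, one_mul, Real.exp_log]
  have : 0 < s - 1 := by linarith
  positivity

lemma dor_mul (β : ℝ) (hβ : β ≠ 0) (x : ℝ) :
      (Real.sqrt (1 + 8 * Real.exp (3 * β * x)) - 1) *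
        (Real.sqrt (1 + 8 * Real.exp (3 * β * ((1 / β) *
          Real.log (2 * Real.exp (β * x) /
            (Real.sqrt (1 + 8 * Real.exp (3 * β * x)) - 1))))) - 1) = 4 := by
  have he := dor_exp β hβ x
  obtain ⟨t, ht, ht1, ht2⟩ := dor_aux β ((1 / β) * Real.log (2 * Real.exp (β * x) /
      (Real.sqrt (1 + 8 * Real.exp (3 * β * x)) - 1)))
  rw [ht]
  rw [he] at ht2
  obtain ⟨s, hs, h1, h2⟩ := dor_aux β x
  rw [hs] at ht2 ⊢
  have hs1 : 0 < s - 1 := by linarith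
  have key : t ^ 2 = ((s + 3) / (s - 1)) ^ 2 := by
    rw [ht2]
    have ha : Real.exp (β * x) ^ 3 = (s ^ 2 - 1) / 8 := by linarith
    rw [div_pow, mul_pow, ha]
    field_simp
    ring
  have : t = (s + 3) / (s - 1) := by
    rwa [sq_eq_sq₀ (by linarith) (by positivity)] at key
  rw [this]
  field_simp
  ring

lemma dor_inv (β : ℝ) (hβ : β ≠ 0) (h : ℝ → ℝ) (hh : h = (fun x : ℝ => (1 / β) *
      Real.log (2 * Real.exp (β * x) /
        (Real.sqrt (1 + 8 * Real.exp (3 * β * x)) - 1)))) : Function.Involutive h := by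
  intro x
  have hx : ∀ y, h y = (1 / β) * Real.log (2 * Real.exp (β * y) /
        (Real.sqrt (1 + 8 * Real.exp (3 * β * y)) - 1)) := fun y => by rw [hh]
  have e : ∀ y, Real.exp (β * h y) = 2 * Real.exp (β * y) /
        (Real.sqrt (1 + 8 * Real.exp (3 * β * y)) - 1) := fun y => by
    rw [hx]; exact dor_exp β hβ y
  have m := dor_mul β hβ x
  rw [← hx] at m
  have : Real.exp (β * h (h x)) = Real.exp (β * x) := by
    rw [e, e]
    obtain ⟨s, hs, h1, -⟩ := dor_aux β x
    obtain ⟨t, ht, ht1, -⟩ := dor_aux β (h x)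
    rw [hs, ht] at m
    rw [hs, ht]
    have hs1 : 0 < s - 1 := by linarith
    have ht1 : 0 < t - 1 := by linarith
    rw [div_eq_iff ht1.ne', mul_div_assoc', div_eq_iff hs1.ne']
    linear_combination (-Real.exp (β * x)) * m
  exact mul_left_cancel₀ hβ (Real.exp_injective this)

lemma dor_sqrt_zero (β : ℝ) : Real.sqrt (1 + 8 * Real.exp (3 * β * 0)) = 3 := by
  rw [mul_zero, Real.exp_zero, show (1 + 8 * 1 : ℝ) = 3 ^ 2 by norm_num]
  exact Real.sqrt_sq (by norm_num)

lemma dor_deriv (β : ℝ) (hβ : β ≠ 0) : HasDerivAt (fun x : ℝ => (1 / β) *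
      Real.log (2 * Real.exp (β * x) /
        (Real.sqrt (1 + 8 * Real.exp (3 * β * x)) - 1))) (-1) 0 := by
  have z := dor_sqrt_zero β
  have a1 : HasDerivAt (fun x : ℝ => 2 * Real.exp (β * x)) (2 * (Real.exp (β * 0) * (β * 1))) 0 :=
    (((hasDerivAt_id (0 : ℝ)).const_mul β).exp).const_mul 2
  have a2 : HasDerivAt (fun x : ℝ => 1 + 8 * Real.exp (3 * β * x))
      (8 * (Real.exp (3 * β * 0) * (3 * β * 1))) 0 :=
    ((((hasDerivAt_id (0 : ℝ)).const_mul (3 * β)).exp).const_mul 8).const_add 1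
  have a3 := (a2.sqrt (by positivity)).sub_const 1
  have a4 := ((a1.fun_div a3 (by rw [z]; norm_num)).log (by rw [z]; norm_num)).const_mul (1 / β)
  refine a4.congr_deriv ?_
  rw [z]
  simp only [mul_zero, Real.exp_zero]
  field_simp
  norm_num

lemma dor_contDiff (β : ℝ) : ContDiff ℝ 1 (fun x : ℝ => (1 / β) *
      Real.log (2 * Real.exp (β * x) /
        (Real.sqrt (1 + 8 * Real.exp (3 * β * x)) - 1))) := by
  have b : ∀ x, Real.sqrt (1 + 8 * Real.exp (3 * β * x)) - 1 ≠ 0 := fun x => by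
    obtain ⟨s, hs, h1, -⟩ := dor_aux β x
    rw [hs]; linarith
  refine contDiff_const.mul (ContDiff.log (ContDiff.div (by fun_prop) (ContDiff.sub
    (ContDiff.sqrt (by fun_prop) fun x => by positivity) contDiff_const) b) fun x => ?_)
  exact div_ne_zero (by positivity) (b x)

/-- for `β ≠ 0`, the Dorignac map
`h x = (1/β) ln( 2 e^{βx} / (√(1 + 8 e^{3βx}) - 1) )` is a strictly decreasing
global involution, and equivalently
`(√(1 + 8 e^{3βx}) - 1)(√(1 + 8 e^{3β h x}) - 1) = 4` for all `x`. -/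
theorem dorignac_global_involution (β : ℝ) (hβ : β ≠ 0) :
    GlobalInvolution (fun x : ℝ => (1 / β) *
      Real.log (2 * Real.exp (β * x) /
        (Real.sqrt (1 + 8 * Real.exp (3 * β * x)) - 1))) ∧
    StrictAnti (fun x : ℝ => (1 / β) *
      Real.log (2 * Real.exp (β * x) /
        (Real.sqrt (1 + 8 * Real.exp (3 * β * x)) - 1))) ∧
    (∀ x : ℝ,
      (Real.sqrt (1 + 8 * Real.exp (3 * β * x)) - 1) *
        (Real.sqrt (1 + 8 * Real.exp (3 * β * ((1 / β) *
          Real.log (2 * Real.exp (β * x) /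
            (Real.sqrt (1 + 8 * Real.exp (3 * β * x)) - 1))))) - 1) = 4) := by
  have inv := dor_inv β hβ _ rfl
  have hd := dor_deriv β hβ
  have hc := dor_contDiff β
  have bij := Function.Involutive.bijective inv
  refine ⟨⟨hc, bij, inv, ?_, hd⟩, ?_, dor_mul β hβ⟩
  · simp only [dor_sqrt_zero]
    norm_num
  · rcases hc.continuous.strictMono_of_inj bij.injective with h | h
    · have := h.monotone.deriv_nonneg (x := 0)
      rw [hd.deriv] at this
      norm_num at this
    · exact h
end
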